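/- arXiv:1906.09377 — 6 statements merged into one kernel-verified Lean document; each statement's English description precedes it below -/
import Mathlib

section
/- Let (X_i)_{i≥1} be i.i.d. exponential random variables with mean 1, and for n ∈ ℕ⁺ let Z_n := max{X̄_1, ..., X̄_n}, where X̄_i := (X_1 + ... + X_i)/i. Then for every x ≥ 0 and every n ∈ ℕ⁺, P(Z_n ≤ x) = 1 − Σ_{k=1}^{n} (k^{k−1}/k!) x^{k−1} e^{−kx}. -/
open MeasureTheory ProbabilityTheory Real

/-- Abel-type polynomials. -/
noncomputable def abelPoly (x : ℝ) : ℕ → ℝ → ℝ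
  | 0, _ => 1
  | j + 1, b => b * (b + (j + 1) * x) ^ j / (Nat.factorial (j + 1))

noncomputable def crossH (x : ℝ) (n : ℕ) (b : ℝ) : ℝ :=
  1 - ∑ j ∈ Finset.range n, abelPoly x j b * Real.exp (-(b + j * x))

/-- The partial sums of `y` stay below the barrier `b, b + x, b + 2x, ...`. -/
def stays (x : ℝ) : (n : ℕ) → ℝ → (Fin n → ℝ) → Prop
  | 0, _, _ => True
  | n + 1, b, y => y 0 ≤ b ∧ stays x n (b - y 0 + x) (fun i => y i.succ)

lemma abelPoly_hasDerivAt (x : ℝ) (j : ℕ) (t : ℝ) :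
    HasDerivAt (abelPoly x (j + 1)) (abelPoly x j (t + x)) t := by
  have h1 : HasDerivAt (fun b : ℝ => b * (b + (j + 1) * x) ^ j / (Nat.factorial (j + 1) : ℝ))
      ((1 * (t + (j + 1) * x) ^ j + t * (j * (t + (j + 1) * x) ^ (j - 1) * 1))
        / (Nat.factorial (j + 1) : ℝ)) t :=
    ((hasDerivAt_id' t).mul (((hasDerivAt_id' t).add_const _).pow j)).div_const _
  have h2 : abelPoly x (j + 1)
      = fun b : ℝ => b * (b + (j + 1) * x) ^ j / (Nat.factorial (j + 1) : ℝ) := by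
    funext b; simp [abelPoly]
  rw [h2]
  convert h1 using 1
  cases j with
  | zero => simp [abelPoly]
  | succ m =>
    have hf : (Nat.factorial (m + 1) : ℝ) ≠ 0 := by positivity
    have hm : (m : ℝ) + 1 + 1 ≠ 0 := by positivity
    rw [Nat.factorial_succ (m + 1)]
    simp only [abelPoly, Nat.add_sub_cancel]
    push_cast
    field_simp
    ring

lemma abelPoly_continuous (x : ℝ) (j : ℕ) : Continuous (abelPoly x j) := by
  cases j with
  | zero => exact continuous_const
  | succ m => exact continuous_iff_continuousAt.2 fun t => (abelPoly_hasDerivAt x m t).continuousAt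

lemma crossH_continuous (x : ℝ) (n : ℕ) : Continuous (crossH x n) := by
  unfold crossH
  have := abelPoly_continuous x
  fun_prop

lemma crossH_integral (x b : ℝ) (n : ℕ) :
    ∫ s in (0 : ℝ)..b, Real.exp (-s) * crossH x n (b - s + x) = crossH x (n + 1) b := by
  have hd : ∀ s ∈ Set.uIcc 0 b, HasDerivAt
      (fun s : ℝ => -Real.exp (-s) + ∑ j ∈ Finset.range n,
        abelPoly x (j + 1) (b - s) * Real.exp (-(b + (j + 1) * x)))
      (Real.exp (-s) * crossH x n (b - s + x)) s := by
    intro s _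
    have h1 : HasDerivAt (fun s : ℝ => b - s) (-1) s := by
      simpa using (hasDerivAt_id' s).const_sub b
    have h2 : HasDerivAt (fun s : ℝ => -Real.exp (-s)) (-(Real.exp (-s) * (-1))) s :=
      ((hasDerivAt_id' s).neg.exp).neg
    have h3 : ∀ j ∈ Finset.range n, HasDerivAt
        (fun s : ℝ => abelPoly x (j + 1) (b - s) * Real.exp (-(b + (j + 1) * x)))
        ((abelPoly x j (b - s + x) * (-1)) * Real.exp (-(b + (j + 1) * x))) s := by
      intro j _
      exact ((abelPoly_hasDerivAt x j (b - s)).comp s h1).mul_const _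
    refine (h2.add (HasDerivAt.fun_sum h3)).congr_deriv ?_
    symm
    unfold crossH
    rw [mul_sub, Finset.mul_sum, sub_eq_add_neg, ← Finset.sum_neg_distrib]
    congr 1
    · ring
    · refine Finset.sum_congr rfl fun j _ => ?_
      have : Real.exp (-(b + (j + 1) * x))
          = Real.exp (-s) * Real.exp (-(b - s + x + j * x)) := by
        rw [← Real.exp_add]; congr 1; ring
      rw [this]; ring
  rw [intervalIntegral.integral_eq_sub_of_hasDerivAt hd]
  · unfold crossH
    rw [Finset.sum_range_succ']
    simp [abelPoly]
    ring
  · have := crossH_continuous x n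
    apply Continuous.intervalIntegrable
    fun_prop

lemma stays_measurable (x : ℝ) (n : ℕ) :
    MeasurableSet {p : ℝ × (Fin n → ℝ) | stays x n p.1 p.2} := by
  induction n with
  | zero => simp [stays]
  | succ n ih =>
    have h1 : MeasurableSet {p : ℝ × (Fin (n + 1) → ℝ) | p.2 0 ≤ p.1} :=
      measurableSet_le (by fun_prop) (by fun_prop)
    have h2 : Measurable (fun p : ℝ × (Fin (n + 1) → ℝ) =>
        ((p.1 - p.2 0 + x, fun i => p.2 i.succ) : ℝ × (Fin n → ℝ))) := by fun_prop
    exact h1.inter (h2 ih)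

lemma stays_measurable' (x : ℝ) (n : ℕ) (b : ℝ) :
    MeasurableSet {y : Fin n → ℝ | stays x n b y} :=
  (measurable_prodMk_left (x := b)) (stays_measurable x n)

lemma stays_measure (x : ℝ) (hx : 0 ≤ x) (n : ℕ) : ∀ b : ℝ, 0 ≤ b →
    0 ≤ crossH x n b ∧
    Measure.pi (fun _ : Fin n => expMeasure 1) {y | stays x n b y}
      = ENNReal.ofReal (crossH x n b) := by
  have : IsProbabilityMeasure (expMeasure 1) := isProbabilityMeasure_expMeasure one_pos
  induction n with
  | zero => intro b _; simp [stays, crossH]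
  | succ n ih =>
    intro b hb
    have hnn : ∀ s ∈ Set.Icc 0 b, 0 ≤ Real.exp (-s) * crossH x n (b - s + x) := by
      intro s hs
      exact mul_nonneg (Real.exp_pos _).le (ih _ (by linarith [hs.2])).1
    have hcont : Continuous fun s => Real.exp (-s) * crossH x n (b - s + x) := by
      have := crossH_continuous x n
      fun_prop
    refine ⟨?_, ?_⟩
    · rw [← crossH_integral]
      exact intervalIntegral.integral_nonneg hb hnn
    have hmp := measurePreserving_piFinSuccAbove (fun _ : Fin (n + 1) => expMeasure 1) 0
    let S : Set (ℝ × (Fin n → ℝ)) := {p | p.1 ≤ b ∧ stays x n (b - p.1 + x) p.2}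
    have hS : MeasurableSet S := by
      have h1 : MeasurableSet {p : ℝ × (Fin n → ℝ) | p.1 ≤ b} :=
        measurableSet_le (by fun_prop) (by fun_prop)
      have h2 : Measurable (fun p : ℝ × (Fin n → ℝ) =>
        ((b - p.1 + x, p.2) : ℝ × (Fin n → ℝ))) := by fun_prop
      exact h1.inter (h2 (stays_measurable x n))
    have h1 : {y : Fin (n + 1) → ℝ | stays x (n + 1) b y}
        = (MeasurableEquiv.piFinSuccAbove (fun _ : Fin (n + 1) => ℝ) 0) ⁻¹' S := by
      rfl
    rw [h1, hmp.measure_preimage hS.nullMeasurableSet, Measure.prod_apply hS,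
      ← crossH_integral, intervalIntegral.integral_of_le hb, ← integral_Icc_eq_integral_Ioc,
      ofReal_integral_eq_lintegral_ofReal]
    · have hm : Measurable fun s : ℝ =>
          Measure.pi (fun _ : Fin n => expMeasure 1) (Prod.mk s ⁻¹' S) :=
        measurable_measure_prodMk_left hS
      have he : expMeasure 1 = volume.withDensity (exponentialPDF 1) := rfl
      have hpm : Measurable (exponentialPDF 1) := by
        unfold exponentialPDF; fun_prop
      rw [← lintegral_indicator measurableSet_Icc]
      have hw := lintegral_withDensity_eq_lintegral_mul volume hpm hm
      rw [← he] at hw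
      refine hw.trans ?_
      refine lintegral_congr fun s => ?_
      by_cases hs : s ∈ Set.Icc 0 b
      · have h3 : Prod.mk s ⁻¹' S = {y : Fin n → ℝ | stays x n (b - s + x) y} := by
          ext y; simp [S, hs.2]
        rw [Set.indicator_of_mem hs, Pi.mul_apply, h3]
        erw [(ih (b - s + x) (by linarith [hs.2])).2]
        rw [exponentialPDF_of_nonneg hs.1, ENNReal.ofReal_mul (Real.exp_pos _).le]
        simp
      · rw [Set.indicator_of_notMem hs, Pi.mul_apply]
        by_cases h0 : 0 ≤ s
        · have h3 : Prod.mk s ⁻¹' S = ∅ := by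
            ext y
            have : ¬ s ≤ b := fun h => hs ⟨h0, h⟩
            simp [S, this]
          rw [h3]; simp
        · rw [exponentialPDF_of_neg (not_le.1 h0)]; simp
    · exact (hcont.integrableOn_Icc)
    · exact (ae_restrict_iff' measurableSet_Icc).2 (ae_of_all _ hnn)

lemma stays_iff (x : ℝ) (n : ℕ) : ∀ (b : ℝ) (y : ℕ → ℝ),
    stays x n b (fun i => y i) ↔ ∀ i < n, ∑ j ∈ Finset.range (i + 1), y j ≤ b + i * x := by
  induction n with
  | zero => intro b y; simp [stays]
  | succ n ih =>
    intro b y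
    have h := ih (b - y 0 + x) (fun i => y (i + 1))
    have hdef : stays x (n + 1) b (fun i => y i)
      ↔ y 0 ≤ b ∧ stays x n (b - y 0 + x) (fun i => y (i + 1)) := Iff.rfl
    rw [hdef, h]
    constructor
    · rintro ⟨h0, h1⟩ i hi
      cases i with
      | zero => simpa using h0
      | succ i =>
        have := h1 i (by omega)
        rw [Finset.sum_range_succ']
        push_cast
        linarith
    · intro h1
      refine ⟨by simpa using h1 0 (by omega), fun i hi => ?_⟩
      have := h1 (i + 1) (by omega)
      rw [Finset.sum_range_succ'] at this
      push_cast at this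
      linarith

/-- If `(X i)` are i.i.d. exponential random variables with mean 1, then the maximum
`Z_n = max{X̄_1, …, X̄_n}` of the first `n` sample means satisfies
`P(Z_n ≤ x) = 1 - ∑_{k=1}^n (k^{k-1}/k!) x^{k-1} e^{-kx}` for all `x ≥ 0`. -/
theorem maxSampleMean_cdf_exponential
    {Ω : Type*} [MeasureSpace Ω] [IsProbabilityMeasure (ℙ : Measure Ω)]
    (X : ℕ → Ω → ℝ) (hmeas : ∀ i, Measurable (X i))
    (hindep : iIndepFun X ℙ)
    (hdist : ∀ i, Measure.map (X i) ℙ = expMeasure 1)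
    (n : ℕ) (hn : 1 ≤ n) (x : ℝ) (hx : 0 ≤ x) :
    (ℙ {ω | ∀ i ∈ Finset.Icc 1 n, (∑ j ∈ Finset.range i, X j ω) / i ≤ x}).toReal
      = 1 - ∑ k ∈ Finset.Icc 1 n,
          (k : ℝ) ^ (k - 1) / (Nat.factorial k) * x ^ (k - 1) * Real.exp (-(k * x)) := by
  have hset : {ω | ∀ i ∈ Finset.Icc 1 n, (∑ j ∈ Finset.range i, X j ω) / i ≤ x}
      = (fun ω (i : Fin n) => X i ω) ⁻¹' {y | stays x n x y} := by
    ext ω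
    have h := stays_iff x n x (fun i => X i ω)
    simp only [Set.mem_preimage, Set.mem_ofPred_eq]
    rw [h]
    constructor
    · intro h1 i hi
      have := h1 (i + 1) (by simp; omega)
      rw [div_le_iff₀ (by positivity)] at this
      push_cast at this
      linarith
    · intro h1 i hi
      obtain ⟨h2, h3⟩ := Finset.mem_Icc.1 hi
      obtain ⟨k, rfl⟩ : ∃ k, i = k + 1 := ⟨i - 1, by omega⟩
      rw [div_le_iff₀ (by positivity)]
      have := h1 k (by omega)
      push_cast
      linarith
  have hind : iIndepFun (fun (i : Fin n) => X i) ℙ := hindep.precomp Fin.val_injective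
  have hmap := (iIndepFun_iff_map_fun_eq_pi_map
    (fun i : Fin n => (hmeas i).aemeasurable)).1 hind
  simp only [hdist] at hmap
  have hst := stays_measure x hx n x hx
  rw [hset, ← Measure.map_apply (by fun_prop) (stays_measurable' x n x), hmap, hst.2,
    ENNReal.toReal_ofReal hst.1]
  unfold crossH
  congr 1
  rw [← Finset.Ico_add_one_right_eq_Icc, Finset.sum_Ico_eq_sum_range, Nat.add_sub_cancel]
  refine Finset.sum_congr rfl fun j _ => ?_
  rw [add_comm 1 j, Nat.add_sub_cancel]
  have he : Real.exp (-(x + j * x)) = Real.exp (-(((j + 1 : ℕ) : ℝ) * x)) := by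
    congr 1; push_cast; ring
  rw [he]
  congr 1
  cases j with
  | zero => simp [abelPoly]
  | succ m =>
    have hf : (Nat.factorial (m + 1) : ℝ) ≠ 0 := by positivity
    have hm : (m : ℝ) + 1 + 1 ≠ 0 := by positivity
    rw [Nat.factorial_succ (m + 1)]
    simp only [abelPoly]
    push_cast
    have : x + ((m : ℝ) + 1) * x = (m + 1 + 1) * x := by ring
    rw [this, mul_pow]
    field_simp
    ring
end

section
/- Let (X_i)_{i≥1} be i.i.d. exponential random variables with mean 1 and Z_∞ := sup{X̄_i : i ∈ ℕ⁺}. Then for every x > 0, P(Z_∞ ≤ x) = 1 − Σ_{k=1}^{∞} (k^{k−1}/k!) x^{k−1} e^{−kx}. -/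
open MeasureTheory ProbabilityTheory Real

namespace SupMean

/-- Abel-type polynomials. -/
noncomputable def A (x : ℝ) : ℕ → ℝ → ℝ
  | 0, _ => 1
  | (k + 1), u => u * (u + (k + 1) * x) ^ k / (Nat.factorial (k + 1))

lemma hasDerivAt_A (x : ℝ) (k : ℕ) (u : ℝ) :
    HasDerivAt (A x (k + 1)) (A x k (u + x)) u := by
  have h1 : HasDerivAt (fun u : ℝ => u + ((k : ℝ) + 1) * x) 1 u := (hasDerivAt_id u).add_const _
  have h2 := ((hasDerivAt_id u).mul (h1.pow k)).div_const ((Nat.factorial (k + 1) : ℕ) : ℝ)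
  have h3 : HasDerivAt (A x (k + 1)) _ u := h2
  convert h3 using 1
  have hf : ((Nat.factorial (k + 1) : ℕ) : ℝ) ≠ 0 := by positivity
  cases k with
  | zero => simp [A]
  | succ m =>
    have hm : ((Nat.factorial (m + 1) : ℕ) : ℝ) ≠ 0 := by positivity
    simp only [A]
    rw [Nat.factorial_succ (m + 1)]
    have : ((m : ℝ) + 1 + 1) ≠ 0 := by positivity
    push_cast
    simp only [id, Pi.pow_apply]
    field_simp
    ring

/-- Candidate distribution function of the running maximum. -/
noncomputable def F (x : ℝ) (n : ℕ) (b : ℝ) : ℝ :=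
  1 - ∑ k ∈ Finset.range n, Real.exp (-(b + (k + 1) * x)) * A x k (b + x)

lemma continuous_A (x : ℝ) (k : ℕ) : Continuous (A x k) := by
  cases k with
  | zero => exact continuous_const
  | succ k => exact continuous_iff_continuousAt.2 fun u => (hasDerivAt_A x k u).continuousAt

lemma continuous_F (x : ℝ) (n : ℕ) : Continuous (F x n) := by
  unfold F
  refine continuous_const.sub (continuous_finsetSum _ fun k _ => ?_)
  exact (by fun_prop : Continuous fun b : ℝ => Real.exp (-(b + (k + 1) * x))).mul
    ((continuous_A x k).comp (by fun_prop))

lemma integral_F (x : ℝ) (n : ℕ) (b : ℝ) :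
    ∫ y in (0 : ℝ)..(b + x), Real.exp (-y) * F x n (b + x - y) = F x (n + 1) b := by
  set c := b + x with hc
  have hd : ∀ y : ℝ, HasDerivAt (fun y => - Real.exp (-y) +
      ∑ k ∈ Finset.range n, Real.exp (-(c + (k + 1) * x)) * A x (k + 1) (c - y))
      (Real.exp (-y) * F x n (c - y)) y := by
    intro y
    have h1 : HasDerivAt (fun y : ℝ => - Real.exp (-y)) (Real.exp (-y)) y := by
      exact (((hasDerivAt_neg y).exp).fun_neg).congr_deriv (by ring)
    have h2 : HasDerivAt (fun y : ℝ => ∑ k ∈ Finset.range n,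
        Real.exp (-(c + (k + 1) * x)) * A x (k + 1) (c - y))
        (∑ k ∈ Finset.range n, Real.exp (-(c + (k + 1) * x)) * (A x k (c - y + x) * (-1))) y := by
      refine HasDerivAt.fun_sum fun k _ => ?_
      refine HasDerivAt.const_mul _ ?_
      exact (hasDerivAt_A x k (c - y)).comp y (by simpa using (hasDerivAt_id y).const_sub c)
    refine (h1.fun_add h2).congr_deriv ?_
    symm
    rw [F, mul_sub, mul_one, sub_eq_add_neg, Finset.mul_sum, ← Finset.sum_neg_distrib]
    congr 1
    refine Finset.sum_congr rfl fun k _ => ?_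
    rw [← mul_assoc, ← Real.exp_add]
    ring_nf
  rw [intervalIntegral.integral_eq_sub_of_hasDerivAt (fun y _ => hd y)]
  · rw [F, Finset.sum_range_succ']
    have : ∀ k : ℕ, c + ((k : ℝ) + 1) * x = b + ((k : ℝ) + 1 + 1) * x := by
      intro k; rw [hc]; ring
    have h0 : ∀ k : ℕ, A x (k + 1) 0 = 0 := by intro k; simp [A]
    simp only [this, ← hc, sub_self, h0, sub_zero, mul_zero, Finset.sum_const_zero]
    push_cast
    simp only [A, hc]
    simp
    ring
  · refine Continuous.intervalIntegrable ?_ _ _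
    exact (by fun_prop : Continuous fun y : ℝ => Real.exp (-y)).mul
      ((continuous_F x n).comp (by fun_prop))

variable {Ω : Type*}

/-- Lindley recursion for the running maximum. -/
noncomputable def W (x : ℝ) : ℕ → (ℕ → Ω → ℝ) → Ω → ℝ
  | 0, _, _ => 0
  | (n + 1), X, ω => max 0 (X 0 ω - x + W x n (fun i => X (i + 1)) ω)

lemma W_nonneg (x : ℝ) (n : ℕ) (X : ℕ → Ω → ℝ) (ω : Ω) : 0 ≤ W x n X ω := by
  cases n <;> simp [W]

lemma W_le_iff (x : ℝ) (n : ℕ) : ∀ (X : ℕ → Ω → ℝ) (ω : Ω) (b : ℝ), W x n X ω ≤ b ↔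
    ∀ i ≤ n, ∑ j ∈ Finset.range i, X j ω ≤ b + i * x := by
  induction n with
  | zero => intro X ω b; simp [W]
  | succ n ih =>
    intro X ω b
    have : X 0 ω - x + W x n (fun i => X (i + 1)) ω ≤ b ↔
        W x n (fun i => X (i + 1)) ω ≤ b + x - X 0 ω := by
      constructor <;> intro h <;> linarith
    simp only [W, max_le_iff]
    rw [this, ih]
    constructor
    · rintro ⟨h0, h⟩ i hi
      cases i with
      | zero => simpa using h0
      | succ i =>
        have := h i (by omega)
        rw [Finset.sum_range_succ']
        push_cast
        linarith
    · intro h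
      refine ⟨by simpa using h 0 (by omega), fun i hi => ?_⟩
      have := h (i + 1) (by omega)
      rw [Finset.sum_range_succ'] at this
      push_cast at this
      linarith

lemma measurable_W (x : ℝ) (n : ℕ) (m : MeasurableSpace Ω) : ∀ (X : ℕ → Ω → ℝ),
    (∀ i, Measurable[m] (X i)) → Measurable[m] (W x n X) := by
  induction n with
  | zero => intro X _; exact measurable_const
  | succ n ih =>
    intro X hX
    exact measurable_const.max (((hX 0).sub_const x).add (ih _ fun i => hX (i + 1)))

lemma indep_W [MeasurableSpace Ω] (μ : Measure Ω) (X : ℕ → Ω → ℝ)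
    (hmeas : ∀ i, Measurable (X i)) (hindep : iIndepFun X μ) (x : ℝ) (n : ℕ) :
    IndepFun (X 0) (W x n (fun i => X (i + 1))) μ := by
  have h := indep_iSup_of_disjoint (fun i => (hmeas i).comap_le) hindep
    (S := {0}) (T := Set.Ici 1) (by simp)
  refine indep_of_indep_of_le_left (indep_of_indep_of_le_right h ?_) ?_
  · refine Measurable.comap_le (measurable_W x n _ _ fun i => ?_)
    refine Measurable.mono (comap_measurable (X (i + 1))) ?_ le_rfl
    exact le_iSup₂_of_le (f := fun (j : ℕ) (_ : j ∈ Set.Ici 1) =>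
      MeasurableSpace.comap (X j) inferInstance) (i + 1) (by simp) le_rfl
  · simp

lemma main [MeasurableSpace Ω] (μ : Measure Ω) [IsProbabilityMeasure μ] (x : ℝ) (hx : 0 < x)
    (n : ℕ) : ∀ (X : ℕ → Ω → ℝ) (_ : ∀ i, Measurable (X i))
    (_ : iIndepFun X μ) (_ : ∀ i, Measure.map (X i) μ = expMeasure 1) (b : ℝ) (_ : 0 ≤ b),
    (μ {ω | W x n X ω ≤ b}).toReal = F x n b := by
  induction n with
  | zero => intro X _ _ _ b hb; simp [W, F, hb]
  | succ n ih =>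
    intro X hmeas hindep hdist b hb
    have ih' := ih (fun i => X (i + 1)) (fun i => hmeas _)
      (hindep.precomp (g := fun i => i + 1) (add_left_injective 1)) (fun i => hdist _)
    set V := W x n (fun i => X (i + 1)) with hV
    have hVm : Measurable V := measurable_W x n _ _ fun i => hmeas (i + 1)
    set c := b + x with hc
    have hc0 : 0 ≤ c := by positivity
    have hFn : ∀ u, 0 ≤ u → 0 ≤ F x n u := fun u hu => by
      rw [← ih' u hu]; positivity
    have hset : {ω | W x (n + 1) X ω ≤ b} =
        (fun ω => (X 0 ω, V ω)) ⁻¹' {p : ℝ × ℝ | p.1 + p.2 ≤ c} := by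
      ext ω
      simp only [W, Set.mem_ofPred_eq, Set.mem_preimage, max_le_iff, hb, true_and, ← hV]
      constructor <;> intro h <;> linarith
    have hms : MeasurableSet {p : ℝ × ℝ | p.1 + p.2 ≤ c} :=
      measurableSet_le (by fun_prop) (by fun_prop)
    have hprod := (indepFun_iff_map_prod_eq_prod_map_map (hmeas 0).aemeasurable
      hVm.aemeasurable).1 (indep_W μ X hmeas hindep x n)
    have : IsProbabilityMeasure (μ.map V) := Measure.isProbabilityMeasure_map hVm.aemeasurable
    have key : μ {ω | W x (n + 1) X ω ≤ b} =
        ∫⁻ y in Set.Icc 0 c, ENNReal.ofReal (Real.exp (-y) * F x n (c - y)) := by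
      rw [hset, ← Measure.map_apply ((hmeas 0).prodMk hVm) hms, hprod, Measure.prod_apply hms,
        hdist 0]
      have hG : Measurable fun y : ℝ =>
          (μ.map V) (Prod.mk y ⁻¹' {p : ℝ × ℝ | p.1 + p.2 ≤ c}) :=
        measurable_measure_prodMk_left hms
      rw [expMeasure, gammaMeasure, lintegral_withDensity_eq_lintegral_mul _ (by
        exact (measurable_gammaPDFReal 1 1).ennreal_ofReal) hG, ← lintegral_indicator measurableSet_Icc]
      refine lintegral_congr fun y => ?_
      have hp : (Prod.mk y ⁻¹' {p : ℝ × ℝ | p.1 + p.2 ≤ c}) = Set.Iic (c - y) := by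
        ext w; simp only [Set.mem_preimage, Set.mem_ofPred_eq, Set.mem_Iic]
        constructor <;> intro h <;> linarith
      simp only [Pi.mul_apply]
      rw [hp, Measure.map_apply hVm measurableSet_Iic]
      by_cases hy0 : 0 ≤ y
      · by_cases hyc : y ≤ c
        · rw [Set.indicator_of_mem (Set.mem_Icc.2 ⟨hy0, hyc⟩), ENNReal.ofReal_mul (by positivity)]
          congr 1
          · simp [gammaPDF, gammaPDFReal, hy0]
          · rw [← ih' (c - y) (by linarith), ENNReal.ofReal_toReal (measure_ne_top _ _)]
            rfl
        · rw [Set.indicator_of_notMem (by simp [hyc])]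
          have : V ⁻¹' Set.Iic (c - y) = ∅ := by
            ext ω
            have := W_nonneg x n (fun i => X (i + 1)) ω
            simp only [Set.mem_preimage, Set.mem_Iic, Set.mem_empty_iff_false, iff_false, not_le,
              hV]
            linarith
          simp [this]
      · rw [Set.indicator_of_notMem (by simp [hy0])]
        simp [gammaPDF, gammaPDFReal, hy0]
    have hcont : Continuous fun y : ℝ => Real.exp (-y) * F x n (c - y) :=
      (by fun_prop : Continuous fun y : ℝ => Real.exp (-y)).mul
        ((continuous_F x n).comp (by fun_prop))
    rw [key, ← integral_F, ← hc, intervalIntegral.integral_of_le hc0,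
      ← integral_Icc_eq_integral_Ioc, integral_eq_lintegral_of_nonneg_ae _
        hcont.aestronglyMeasurable]
    filter_upwards [ae_restrict_mem measurableSet_Icc] with y hy
    exact mul_nonneg (by positivity) (hFn _ (by linarith [hy.2]))

end SupMean

/-- If `(X i)` are i.i.d. exponential random variables with mean 1 and
`Z_∞ = sup{X̄_i : i ≥ 1}`, then for every `x > 0`,
`P(Z_∞ ≤ x) = 1 - ∑_{k=1}^∞ (k^{k-1}/k!) x^{k-1} e^{-kx}`
(the sum over `k ≥ 1` is written below as a sum over `k ∈ ℕ` shifted by one). -/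
theorem supSampleMean_cdf_exponential
    {Ω : Type*} [MeasureSpace Ω] [IsProbabilityMeasure (ℙ : Measure Ω)]
    (X : ℕ → Ω → ℝ) (hmeas : ∀ i, Measurable (X i))
    (hindep : iIndepFun X ℙ)
    (hdist : ∀ i, Measure.map (X i) ℙ = expMeasure 1)
    (x : ℝ) (hx : 0 < x) :
    (ℙ {ω | ∀ i : ℕ, 1 ≤ i → (∑ j ∈ Finset.range i, X j ω) / i ≤ x}).toReal
      = 1 - ∑' k : ℕ,
          ((k : ℝ) + 1) ^ k / (Nat.factorial (k + 1)) * x ^ k * Real.exp (-((k + 1) * x)) := by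
  have hset : {ω | ∀ i : ℕ, 1 ≤ i → (∑ j ∈ Finset.range i, X j ω) / i ≤ x} =
      ⋂ n, {ω | SupMean.W x n X ω ≤ 0} := by
    ext ω
    simp only [Set.mem_ofPred_eq, Set.mem_iInter, SupMean.W_le_iff, zero_add]
    constructor
    · intro h n i _
      rcases Nat.eq_zero_or_pos i with rfl | hi
      · simp
      · have := h i hi
        rw [div_le_iff₀ (by positivity)] at this
        linarith
    · intro h i hi
      rw [div_le_iff₀ (by positivity)]
      linarith [h i i le_rfl]
  have hanti : Antitone fun n => {ω | SupMean.W x n X ω ≤ 0} := by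
    intro m n hmn ω
    simp only [Set.mem_ofPred_eq, SupMean.W_le_iff]
    exact fun h i hi => h i (hi.trans hmn)
  have ht := tendsto_measure_iInter_atTop (μ := (ℙ : Measure Ω))
    (fun n => (measurableSet_le (SupMean.measurable_W x n _ X hmeas)
      measurable_const).nullMeasurableSet) hanti ⟨0, measure_ne_top _ _⟩
  rw [← hset] at ht
  have ht2 := (ENNReal.tendsto_toReal (measure_ne_top _ _)).comp ht
  set L := (ℙ {ω | ∀ i : ℕ, 1 ≤ i → (∑ j ∈ Finset.range i, X j ω) / i ≤ x}).toReal
  have hs : HasSum (fun k : ℕ => ((k : ℝ) + 1) ^ k / (Nat.factorial (k + 1)) * x ^ k *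
      Real.exp (-((k + 1) * x))) (1 - L) := by
    rw [hasSum_iff_tendsto_nat_of_nonneg (fun k => by positivity)]
    have ht3 := ht2.const_sub 1
    refine ht3.congr fun n => ?_
    simp only [Function.comp]
    rw [SupMean.main ℙ x hx n X hmeas hindep hdist 0 le_rfl, SupMean.F, sub_sub_cancel]
    refine Finset.sum_congr rfl fun k _ => ?_
    rw [zero_add, zero_add, mul_comm]
    congr 1
    cases k with
    | zero => simp [SupMean.A]
    | succ k =>
      simp only [SupMean.A]
      rw [Nat.factorial_succ (k + 1), show x + ((k : ℝ) + 1) * x = (k + 2) * x by ring, mul_pow]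
      have hf : ((Nat.factorial (k + 1) : ℕ) : ℝ) ≠ 0 := by positivity
      have : (k : ℝ) + 2 ≠ 0 := by positivity
      push_cast
      rw [show (k : ℝ) + 1 + 1 = k + 2 by ring]
      field_simp
      ring
  rw [hs.tsum_eq]
  ring
end

section
/- Let F_∞ be the cumulative distribution function of Z_∞ := sup{X̄_i : i ∈ ℕ⁺}, where (X_i)_{i≥1} are i.i.d. exponential with mean 1. Then the restriction of F_∞ to the interval (1, ∞) is strictly increasing and is a bijection from (1, ∞) onto (0, 1). -/
open MeasureTheory ProbabilityTheory Real Set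

namespace SupMean

open scoped ENNReal

instance : IsProbabilityMeasure (expMeasure 1) := isProbabilityMeasure_expMeasure one_pos

/-- law of the iid sequence -/
noncomputable def piLaw : Measure (ℕ → ℝ) := Measure.infinitePi (fun _ => expMeasure 1)

instance : IsProbabilityMeasure piLaw := by unfold piLaw; infer_instance

def consMap (p : ℝ × (ℕ → ℝ)) : ℕ → ℝ := fun n => Nat.casesOn n p.1 p.2

lemma consMap_zero (p : ℝ × (ℕ → ℝ)) : consMap p 0 = p.1 := rfl

lemma consMap_succ (p : ℝ × (ℕ → ℝ)) (n : ℕ) : consMap p (n + 1) = p.2 n := rfl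

lemma measurable_consMap : Measurable consMap := by
  rw [measurable_pi_iff]
  intro n
  cases n with
  | zero => exact measurable_fst
  | succ n => exact (measurable_pi_apply n).comp measurable_snd

lemma map_consMap : ((expMeasure 1).prod piLaw).map consMap = piLaw := by
  classical
  conv_rhs => rw [piLaw]
  apply Measure.eq_infinitePi
  intro s t ht
  obtain ⟨N, hN⟩ : ∃ N, s ⊆ Finset.range (N + 1) :=
    ⟨s.sup id, fun i hi => by
      simpa [Nat.lt_succ_iff] using Finset.le_sup (f := id) hi⟩
  set t' : ℕ → Set ℝ := fun i => if i ∈ s then t i else univ with ht'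
  have mt' : ∀ i, MeasurableSet (t' i) := by
    intro i
    simp only [ht']
    split_ifs
    · exact ht i
    · exact MeasurableSet.univ
  have h1 : Set.pi (s : Set ℕ) t = Set.pi (Finset.range (N + 1) : Set ℕ) t' := by
    ext y
    simp only [Set.mem_pi, ht']
    constructor
    · intro h i _
      split_ifs with hi
      · exact h i hi
      · trivial
    · intro h i hi
      have := h i (hN hi)
      rwa [if_pos (by exact hi)] at this
  have h2 : ∏ i ∈ s, expMeasure 1 (t i) = ∏ i ∈ Finset.range (N + 1), expMeasure 1 (t' i) := by
    rw [← Finset.prod_subset hN]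
    · refine Finset.prod_congr rfl fun i hi => ?_
      simp only [ht', if_pos hi]
    · intro i _ hi
      simp only [ht', if_neg hi, measure_univ]
  rw [h1, h2, Measure.map_apply measurable_consMap
    (MeasurableSet.pi (Finset.countable_toSet _) fun i _ => mt' i)]
  have h3 : consMap ⁻¹' (Set.pi (Finset.range (N + 1) : Set ℕ) t')
      = t' 0 ×ˢ Set.pi (Finset.range N : Set ℕ) (fun i => t' (i + 1)) := by
    ext ⟨a, y⟩
    simp only [mem_preimage, Set.mem_pi, mem_prod, Finset.coe_range, mem_Iio]
    constructor
    · intro h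
      exact ⟨h 0 (by omega), fun i hi => h (i + 1) (by omega)⟩
    · rintro ⟨h0, h⟩ i hi
      cases i with
      | zero => exact h0
      | succ i => exact h i (by omega)
  rw [h3, Measure.prod_prod, piLaw, Measure.infinitePi_pi _ (fun i _ => mt' _),
    Finset.prod_range_succ', mul_comm]

def evt (x : ℝ) (n : ℕ∞) (u : ℝ) : Set (ℕ → ℝ) :=
  {y | ∀ i : ℕ, (i : ℕ∞) < n → ∑ j ∈ Finset.range (i + 1), y j ≤ (i + 1) * x + u}

lemma measurableSet_evt (x n u) : MeasurableSet (evt x n u) := by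
  have : evt x n u = ⋂ i : ℕ, ⋂ (_ : (i : ℕ∞) < n),
      {y | ∑ j ∈ Finset.range (i + 1), y j ≤ (i + 1) * x + u} := by
    ext y; simp [evt]
  rw [this]
  refine MeasurableSet.iInter fun i => MeasurableSet.iInter fun _ => ?_
  exact measurableSet_le (by fun_prop) (by fun_prop)

lemma evt_rec (x : ℝ) (n : ℕ∞) (u : ℝ) :
    piLaw (evt x (n + 1) u)
      = ∫⁻ t in Iic (u + x), piLaw (evt x n (u + x - t)) ∂(expMeasure 1) := by
  conv_lhs => rw [← map_consMap]
  rw [Measure.map_apply measurable_consMap (measurableSet_evt _ _ _),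
    Measure.prod_apply (measurable_consMap (measurableSet_evt _ _ _)),
    ← lintegral_indicator measurableSet_Iic]
  refine lintegral_congr fun t => ?_
  have key : ∀ y, consMap (t, y) ∈ evt x (n + 1) u ↔ t ≤ u + x ∧ y ∈ evt x n (u + x - t) := by
    intro y
    constructor
    · intro h
      constructor
      · have := h 0 (by simp)
        simp [consMap] at this
        linarith
      · intro i hi
        have := h (i + 1) (by push_cast; exact (ENat.add_lt_add_iff_right (by simp)).2 hi)
        rw [Finset.sum_range_succ'] at this
        simp only [consMap_zero, consMap_succ] at this
        push_cast at this
        linarith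
    · rintro ⟨h0, h⟩ i hi
      cases i with
      | zero => simp [consMap]; linarith
      | succ i =>
        have := h i (by push_cast at hi; exact (ENat.add_lt_add_iff_right (by simp)).1 hi)
        rw [Finset.sum_range_succ']
        simp only [consMap_zero, consMap_succ]
        push_cast
        linarith
  by_cases ht : t ≤ u + x
  · rw [indicator_of_mem (by exact ht)]
    congr 1
    ext y
    simp [key, ht]
  · rw [indicator_of_notMem (by exact ht)]
    convert measure_empty (μ := piLaw)
    ext y
    simp [key, ht]

/-- the harmonic function -/
noncomputable def gf (θ u : ℝ) : ℝ := 1 - (1 - θ) * exp (-θ * u)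

lemma gf_nonneg {θ u : ℝ} (h0 : 0 < θ) (h1 : θ < 1) (hu : 0 ≤ u) : 0 ≤ gf θ u := by
  have : exp (-θ * u) ≤ 1 := exp_le_one_iff.2 (by nlinarith)
  have := exp_pos (-θ * u)
  unfold gf
  nlinarith

lemma gf_le_one {θ u : ℝ} (h1 : θ < 1) : gf θ u ≤ 1 := by
  have := exp_pos (-θ * u)
  unfold gf
  nlinarith

lemma integral_gf (θ c a : ℝ) :
    ∫ t in (0:ℝ)..a, exp (-t) * (gf θ (a - t) + c)
      = 1 - exp (-θ * a) + c * (1 - exp (-a)) := by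
  have hd : ∀ t ∈ uIcc 0 a, HasDerivAt
      (fun t => -(1 + c) * exp (-t) + exp (-θ * a) * exp (-(1 - θ) * t))
      (exp (-t) * (gf θ (a - t) + c)) t := by
    intro t _
    have h1 : HasDerivAt (fun t : ℝ => exp (-t)) (exp (-t) * (-1)) t :=
      (hasDerivAt_neg t).exp
    have h2 : HasDerivAt (fun t : ℝ => exp (-(1 - θ) * t)) (exp (-(1 - θ) * t) * (-(1 - θ) * 1)) t :=
      ((hasDerivAt_id t).const_mul (-(1 - θ))).exp
    refine ((h1.const_mul (-(1 + c))).add (h2.const_mul (exp (-θ * a)))).congr_deriv ?_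
    have e1 : exp (-t) * exp (-θ * (a - t)) = exp (-θ * a) * exp (-(1 - θ) * t) := by
      rw [← exp_add, ← exp_add]; ring_nf
    unfold gf
    linear_combination (1 - θ) * e1
  rw [intervalIntegral.integral_eq_sub_of_hasDerivAt hd]
  · have e2 : exp (-θ * a) * exp (-(1 - θ) * a) = exp (-a) := by
      rw [← exp_add]; ring_nf
    rw [e2]
    simp
    ring
  · apply Continuous.intervalIntegrable
    unfold gf
    fun_prop

lemma lintegral_gf {θ c a : ℝ} (h0 : 0 < θ) (h1 : θ < 1) (hc : 0 ≤ c) (ha : 0 ≤ a) :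
    ∫⁻ t in Iic a, ENNReal.ofReal (gf θ (a - t) + c) ∂(expMeasure 1)
      = ENNReal.ofReal (1 - exp (-θ * a) + c * (1 - exp (-a))) := by
  have hm : expMeasure 1 = volume.withDensity (exponentialPDF 1) := rfl
  have hgc : Continuous (fun t => gf θ (a - t) + c) := by unfold gf; fun_prop
  have hpm : Measurable (exponentialPDF 1) :=
    (measurable_exponentialPDFReal 1).ennreal_ofReal
  rw [hm, setLIntegral_withDensity_eq_setLIntegral_mul _ hpm
    hgc.measurable.ennreal_ofReal measurableSet_Iic]
  rw [← integral_gf, intervalIntegral.integral_of_le ha, ← integral_Icc_eq_integral_Ioc,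
    ofReal_integral_eq_lintegral_ofReal]
  · rw [← lintegral_indicator measurableSet_Iic, ← lintegral_indicator measurableSet_Icc]
    refine lintegral_congr fun t => ?_
    by_cases h : t ≤ a
    · by_cases h' : 0 ≤ t
      · rw [indicator_of_mem (by exact h), indicator_of_mem (by exact ⟨h', h⟩)]
        simp only [Pi.mul_apply]
        rw [exponentialPDF_of_nonneg h', ← ENNReal.ofReal_mul (by positivity)]
        simp
      · rw [indicator_of_mem (by exact h), indicator_of_notMem (fun hh => h' hh.1)]
        simp [exponentialPDF_of_neg (not_le.1 h')]
    · rw [indicator_of_notMem (by exact h), indicator_of_notMem (fun hh => h hh.2)]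
  · apply ContinuousOn.integrableOn_Icc
    exact (Continuous.mul (by fun_prop) hgc).continuousOn
  · rw [Filter.EventuallyLE, ae_restrict_iff' measurableSet_Icc]
    refine ae_of_all _ fun t ht => ?_
    have := gf_nonneg h0 h1 (sub_nonneg.2 ht.2)
    simp only [Pi.zero_apply]
    positivity

lemma gf_shift {θ x u : ℝ} (hx : exp (-θ * x) = 1 - θ) :
    1 - exp (-θ * (u + x)) = gf θ u := by
  rw [mul_add, exp_add, hx, gf]; ring

lemma lower_fin {θ x : ℝ} (h0 : 0 < θ) (h1 : θ < 1) (hx0 : 0 < x)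
    (hx : exp (-θ * x) = 1 - θ) (n : ℕ) :
    ∀ u, 0 ≤ u → ENNReal.ofReal (gf θ u) ≤ piLaw (evt x n u) := by
  induction n with
  | zero =>
    intro u hu
    have : evt x (0 : ℕ) u = univ := by ext y; simp [evt]
    rw [this, measure_univ]
    exact ENNReal.ofReal_le_one.2 (gf_le_one h1)
  | succ n ih =>
    intro u hu
    push_cast
    rw [evt_rec]
    have := lintegral_gf (c := 0) (a := u + x) h0 h1 le_rfl (by linarith)
    rw [gf_shift hx] at this
    simp only [zero_mul, add_zero] at this
    rw [← this]
    refine setLIntegral_mono' measurableSet_Iic fun t ht => ih _ (sub_nonneg.2 ht)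

lemma lower {θ x : ℝ} (h0 : 0 < θ) (h1 : θ < 1) (hx0 : 0 < x)
    (hx : exp (-θ * x) = 1 - θ) {u : ℝ} (hu : 0 ≤ u) :
    ENNReal.ofReal (gf θ u) ≤ piLaw (evt x ⊤ u) := by
  have he : evt x ⊤ u = ⋂ n : ℕ, evt x n u := by
    ext y
    simp only [evt, mem_iInter, mem_setOf_eq]
    constructor
    · intro h n i _
      exact h i (ENat.coe_lt_top i)
    · intro h i _
      exact h (i + 1) i (by exact_mod_cast Nat.lt_succ_self i)
  rw [he, Antitone.measure_iInter]
  · exact le_iInf fun n => lower_fin h0 h1 hx0 hx n u hu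
  · intro m n hmn y hy i hi
    exact hy i (hi.trans_le (by exact_mod_cast hmn))
  · exact fun n => (measurableSet_evt _ _ _).nullMeasurableSet
  · exact ⟨0, measure_ne_top _ _⟩

lemma upper_iter {θ x ε M : ℝ} (h0 : 0 < θ) (h1 : θ < 1) (hx0 : 0 < x)
    (hx : exp (-θ * x) = 1 - θ) (hε : 0 < ε) (hM : 0 ≤ M)
    (hMε : exp (-θ * M) ≤ ε) (k : ℕ) :
    ∀ u, 0 ≤ u → piLaw (evt x ⊤ u)
      ≤ ENNReal.ofReal (gf θ u + (ε + (1 - exp (-(M + x))) ^ k)) := by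
  have hρ : 0 ≤ 1 - exp (-(M + x)) := by
    have : exp (-(M + x)) ≤ 1 := exp_le_one_iff.2 (by linarith)
    linarith
  induction k with
  | zero =>
    intro u hu
    refine prob_le_one.trans (ENNReal.one_le_ofReal.2 ?_)
    have := gf_nonneg h0 h1 hu
    simp; linarith
  | succ k ih =>
    intro u hu
    by_cases huM : M ≤ u
    · refine prob_le_one.trans (ENNReal.one_le_ofReal.2 ?_)
      have e1 : exp (-θ * u) ≤ exp (-θ * M) := exp_le_exp.2 (by nlinarith)
      have e2 := exp_pos (-θ * u)
      have := pow_nonneg hρ (k + 1)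
      unfold gf
      nlinarith
    · have hrec := evt_rec x ⊤ u
      rw [top_add] at hrec
      rw [hrec]
      set ρ := 1 - exp (-(M + x)) with hρd
      have hp := pow_nonneg hρ k
      have := lintegral_gf (c := ε + ρ ^ k) (a := u + x) h0 h1 (by positivity) (by linarith)
      rw [gf_shift hx] at this
      calc _ ≤ ∫⁻ t in Iic (u + x), ENNReal.ofReal (gf θ (u + x - t) + (ε + ρ ^ k))
            ∂(expMeasure 1) :=
            setLIntegral_mono' measurableSet_Iic fun t ht => ih _ (sub_nonneg.2 ht)
        _ = _ := this
        _ ≤ _ := by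
          apply ENNReal.ofReal_le_ofReal
          have e1 : 1 - exp (-(u + x)) ≤ ρ := by
            have : exp (-(M + x)) ≤ exp (-(u + x)) := exp_le_exp.2 (by linarith)
            linarith
          have e2 : 1 - exp (-(u + x)) ≤ 1 := by linarith [exp_pos (-(u + x))]
          have e3 : ρ ^ k * (1 - exp (-(u + x))) ≤ ρ ^ k * ρ :=
            mul_le_mul_of_nonneg_left e1 hp
          rw [pow_succ]
          nlinarith

lemma upper {θ x : ℝ} (h0 : 0 < θ) (h1 : θ < 1) (hx0 : 0 < x)
    (hx : exp (-θ * x) = 1 - θ) {u : ℝ} (hu : 0 ≤ u) :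
    (piLaw (evt x ⊤ u)).toReal ≤ gf θ u := by
  have hg := gf_nonneg h0 h1 hu
  refine le_of_forall_pos_le_add fun ε hε => ?_
  obtain ⟨M, hM, hMε⟩ : ∃ M : ℝ, 0 ≤ M ∧ exp (-θ * M) ≤ ε := by
    refine ⟨|log ε| / θ, by positivity, ?_⟩
    have : -θ * (|log ε| / θ) = -|log ε| := by field_simp
    rw [this]
    calc exp (-|log ε|) ≤ exp (log ε) := exp_le_exp.2 (neg_abs_le _)
      _ = ε := exp_log hε
  have hρ : 0 ≤ 1 - exp (-(M + x)) := by
    have : exp (-(M + x)) ≤ 1 := exp_le_one_iff.2 (by linarith)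
    linarith
  have hρ1 : 1 - exp (-(M + x)) < 1 := by linarith [exp_pos (-(M + x))]
  have hlim := (tendsto_pow_atTop_nhds_zero_of_lt_one hρ hρ1).const_add (gf θ u + ε)
  rw [add_zero] at hlim
  refine ge_of_tendsto' hlim fun k => ?_
  have := upper_iter h0 h1 hx0 hx hε hM hMε k u hu
  have hp := pow_nonneg hρ k
  have := ENNReal.toReal_le_of_le_ofReal (by positivity) this
  linarith

lemma value {θ x : ℝ} (h0 : 0 < θ) (h1 : θ < 1) (hx0 : 0 < x)
    (hx : exp (-θ * x) = 1 - θ) : (piLaw (evt x ⊤ 0)).toReal = θ := by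
  have hg : gf θ 0 = θ := by simp [gf]
  apply le_antisymm
  · simpa [hg] using upper h0 h1 hx0 hx le_rfl
  · have := lower h0 h1 hx0 hx le_rfl
    rw [hg] at this
    exact (ENNReal.ofReal_le_iff_le_toReal (measure_ne_top _ _)).1 this

lemma exists_theta {x : ℝ} (hx : 1 < x) : ∃ θ, 0 < θ ∧ θ < 1 ∧ exp (-θ * x) = 1 - θ := by
  set δ := (x - 1) / (2 * x) with hδ
  have hδ0 : 0 < δ := div_pos (by linarith) (by linarith)
  have hδx : δ * x = (x - 1) / 2 := by rw [hδ]; field_simp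
  have hδ1 : δ ≤ 1 := by
    rw [hδ, div_le_one (by linarith)]; linarith
  have hcont : ContinuousOn (fun s : ℝ => exp (-s * x) - (1 - s)) (Icc δ 1) := by fun_prop
  have hneg : exp (-δ * x) - (1 - δ) ≤ 0 := by
    have h1 : exp (-δ * x) ≤ 1 / (1 + δ * x) := by
      rw [neg_mul, exp_neg, one_div]
      apply inv_anti₀ (by nlinarith)
      linarith [add_one_le_exp (δ * x)]
    have h2 : 1 / (1 + δ * x) ≤ 1 - δ := by
      rw [div_le_iff₀ (by nlinarith)]
      nlinarith
    linarith
  have hpos : 0 ≤ exp (-1 * x) - (1 - 1) := by linarith [exp_pos (-1 * x)]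
  obtain ⟨θ, ⟨h1, h2⟩, h3⟩ := intermediate_value_Icc hδ1 hcont ⟨hneg, hpos⟩
  have h3' : exp (-θ * x) = 1 - θ := by simp only at h3; linarith
  exact ⟨θ, by linarith, by linarith [exp_pos (-θ * x)], h3'⟩

lemma exists_x {θ : ℝ} (h0 : 0 < θ) (h1 : θ < 1) : ∃ x, 1 < x ∧ exp (-θ * x) = 1 - θ := by
  refine ⟨-log (1 - θ) / θ, ?_, ?_⟩
  · rw [lt_div_iff₀ h0]
    have := log_lt_sub_one_of_pos (x := 1 - θ) (by linarith) (by linarith)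
    linarith
  · have : -θ * (-log (1 - θ) / θ) = log (1 - θ) := by field_simp
    rw [this, exp_log (by linarith)]

end SupMean

/-- Let `F_∞` be the CDF of `Z_∞ = sup{X̄_i : i ≥ 1}`, where the `X i` are i.i.d.
exponential with mean 1. Then the restriction of `F_∞` to `(1, ∞)` is strictly
increasing and a bijection from `(1, ∞)` onto `(0, 1)`. -/
theorem supSampleMean_cdf_bijOn
    {Ω : Type*} [MeasureSpace Ω] [IsProbabilityMeasure (ℙ : Measure Ω)]
    (X : ℕ → Ω → ℝ) (hmeas : ∀ i, Measurable (X i))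
    (hindep : iIndepFun X ℙ)
    (hdist : ∀ i, Measure.map (X i) ℙ = expMeasure 1)
    (F : ℝ → ℝ)
    (hF : ∀ x : ℝ, F x =
      (ℙ {ω | ∀ i : ℕ, 1 ≤ i → (∑ j ∈ Finset.range i, X j ω) / i ≤ x}).toReal) :
    StrictMonoOn F (Ioi 1) ∧ BijOn F (Ioi 1) (Ioo 0 1) := by
  have hlaw : Measure.map (fun ω i => X i ω) (ℙ : Measure Ω) = SupMean.piLaw := by
    rw [hindep.map_fun_eq_infinitePi_map hmeas, SupMean.piLaw]
    simp only [hdist]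
  have hFQ : ∀ x, F x = (SupMean.piLaw (SupMean.evt x ⊤ 0)).toReal := by
    intro x
    rw [hF, ← hlaw, Measure.map_apply (measurable_pi_iff.2 hmeas)
      (SupMean.measurableSet_evt _ _ _)]
    congr 2
    ext ω
    simp only [mem_setOf_eq, mem_preimage, SupMean.evt]
    constructor
    · intro h i _
      have := h (i + 1) (by omega)
      rw [div_le_iff₀ (by positivity)] at this
      push_cast at this
      linarith
    · intro h i hi
      obtain ⟨k, rfl⟩ : ∃ k, i = k + 1 := ⟨i - 1, by omega⟩
      have := h k (ENat.coe_lt_top k)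
      rw [div_le_iff₀ (by positivity)]
      push_cast
      linarith
  have hval : ∀ θ x : ℝ, 0 < θ → θ < 1 → 1 < x → exp (-θ * x) = 1 - θ → F x = θ :=
    fun θ x h0 h1 hx h => (hFQ x).trans (SupMean.value h0 h1 (by linarith) h)
  have hinj : InjOn F (Ioi 1) := by
    intro x hx y hy hxy
    obtain ⟨θ, h0, h1, h⟩ := SupMean.exists_theta hx
    obtain ⟨η, h0', h1', h'⟩ := SupMean.exists_theta hy
    have e : θ = η := by rw [← hval θ x h0 h1 hx h, ← hval η y h0' h1' hy h', hxy]
    subst e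
    have := exp_injective (h.trans h'.symm)
    nlinarith [mul_left_cancel₀ (neg_ne_zero.2 h0.ne') this]
  have hmono : Monotone F := by
    intro x y hxy
    rw [hF, hF]
    refine ENNReal.toReal_mono (measure_ne_top _ _) (measure_mono fun ω h i hi => ?_)
    exact (h i hi).trans hxy
  refine ⟨?_, ?_, hinj, ?_⟩
  · intro x hx y hy hxy
    exact lt_of_le_of_ne (hmono hxy.le) fun h => hxy.ne (hinj hx hy h)
  · intro x hx
    obtain ⟨θ, h0, h1, h⟩ := SupMean.exists_theta hx
    rw [hval θ x h0 h1 hx h]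
    exact ⟨h0, h1⟩
  · rintro θ ⟨h0, h1⟩
    obtain ⟨x, hx, h⟩ := SupMean.exists_x h0 h1
    exact ⟨x, hx, hval θ x h0 h1 hx h⟩
end

section
/- Let F_∞ be the cumulative distribution function of Z_∞ := sup{X̄_i : i ∈ ℕ⁺}, where (X_i)_{i≥1} are i.i.d. exponential with mean 1. Then for every u ∈ (0, 1), F_∞( −log(1−u)/u ) = u; that is, the inverse of the restriction of F_∞ to (1, ∞) is given by F_∞^{−1}(u) = −log(1−u)/u for u ∈ (0, 1). -/
open MeasureTheory ProbabilityTheory Real Set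

/-- Sequences whose walk stays below the line of slope `x` up to time `n`. -/
def survSet (x : ℝ) (n : ℕ) : Set (ℕ → ℝ) :=
  {v | ∀ i ≤ n, ∑ j ∈ Finset.range i, v j ≤ i * x}

lemma measurableSet_survSet (x : ℝ) (n : ℕ) : MeasurableSet (survSet x n) := by
  have : survSet x n = ⋂ i, ⋂ (_ : i ≤ n), {v | ∑ j ∈ Finset.range i, v j ≤ i * x} := by
    ext v; simp [survSet]
  rw [this]
  refine MeasurableSet.iInter fun i => MeasurableSet.iInter fun _ => ?_
  exact measurableSet_le (by fun_prop) (by fun_prop)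

lemma survSet_congr (x : ℝ) (n : ℕ) (v w : ℕ → ℝ) (h : ∀ j < n, v j = w j) :
    v ∈ survSet x n ↔ w ∈ survSet x n := by
  have : ∀ i ≤ n, ∑ j ∈ Finset.range i, v j = ∑ j ∈ Finset.range i, w j := fun i hi =>
    Finset.sum_congr rfl fun j hj => h j (by have := Finset.mem_range.1 hj; omega)
  constructor
  · intro hv i hi; rw [← this i hi]; exact hv i hi
  · intro hv i hi; rw [this i hi]; exact hv i hi

lemma survSet_succ (x : ℝ) (n : ℕ) (v : ℕ → ℝ) :
    v ∈ survSet x (n + 1) ↔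
      v ∈ survSet x n ∧ v n ≤ n * x - ∑ j ∈ Finset.range n, v j + x := by
  constructor
  · intro h
    refine ⟨fun i hi => h i (by omega), ?_⟩
    have := h (n + 1) le_rfl
    rw [Finset.sum_range_succ] at this
    push_cast at this
    linarith
  · rintro ⟨h1, h2⟩ i hi
    rcases Nat.lt_or_ge n i with h | h
    · obtain rfl : i = n + 1 := by omega
      rw [Finset.sum_range_succ]
      push_cast
      linarith
    · exact h1 i h

/-- One step operator. -/
noncomputable def stepJ (g : ℝ → ℝ) (z : ℝ) : ENNReal :=
  ∫⁻ s, (Iic z).indicator (fun s => ENNReal.ofReal (g (z - s))) s ∂(expMeasure 1)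

lemma stepJ_eq (g Φ : ℝ → ℝ) (hgm : Continuous g) (hg : ∀ y, 0 ≤ y → 0 ≤ g y) (z : ℝ) (hz : 0 ≤ z)
    (hΦ : ∀ s, HasDerivAt Φ (exp (-s) * g (z - s)) s) :
    stepJ g z = ENNReal.ofReal (Φ z - Φ 0) := by
  have hm : Measurable g := hgm.measurable
  have hcont : Continuous (fun s => exp (-s) * g (z - s)) := by fun_prop
  unfold stepJ expMeasure gammaMeasure
  rw [lintegral_withDensity_eq_lintegral_mul _
    (show Measurable (gammaPDF 1 1) from (measurable_gammaPDFReal 1 1).ennreal_ofReal)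
    (Measurable.indicator (by fun_prop) measurableSet_Iic)]
  have : ∀ s, (gammaPDF 1 1 * (Iic z).indicator (fun s => ENNReal.ofReal (g (z - s)))) s
      = (Icc 0 z).indicator (fun s => ENNReal.ofReal (exp (-s) * g (z - s))) s := by
    intro s
    change exponentialPDF 1 s * _ = _
    rw [exponentialPDF_eq]
    by_cases h0 : 0 ≤ s
    · by_cases h1 : s ≤ z
      · simp [h0, h1, ENNReal.ofReal_mul (exp_pos _).le]
      · simp [h1]
    · simp [h0]
  rw [lintegral_congr this, lintegral_indicator measurableSet_Icc,
    ← ofReal_integral_eq_lintegral_ofReal]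
  · rw [integral_Icc_eq_integral_Ioc, ← intervalIntegral.integral_of_le hz,
      intervalIntegral.integral_eq_sub_of_hasDerivAt (fun s _ => hΦ s)
        (hcont.intervalIntegrable _ _)]
  · exact hcont.continuousOn.integrableOn_Icc
  · filter_upwards [ae_restrict_mem measurableSet_Icc] with s hs
    exact mul_nonneg (exp_pos _).le (hg _ (by linarith [hs.2]))

lemma stepJ_h (u : ℝ) (hu : u ∈ Ioo (0 : ℝ) 1) (z : ℝ) (hz : 0 ≤ z) :
    stepJ (fun y => 1 - (1 - u) * exp (-(u * y))) z = ENNReal.ofReal (1 - exp (-(u * z))) := by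
  rw [stepJ_eq _ (fun s => -exp (-s) + exp (-(u * z)) * exp (-((1 - u) * s))) (by fun_prop) _ z hz]
  · congr 1
    rw [← exp_add, ← exp_add]
    ring_nf
    simp
  · intro s
    have h1 : HasDerivAt (fun s : ℝ => exp (-s)) (exp (-s) * (-1)) s := (hasDerivAt_neg s).exp
    have h2 : HasDerivAt (fun s : ℝ => exp (-((1 - u) * s)))
        (exp (-((1 - u) * s)) * (-((1 - u) * 1))) s :=
      ((hasDerivAt_id s).const_mul (1 - u)).neg.exp
    convert! h1.neg.add (h2.const_mul (exp (-(u * z)))) using 1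
    have e1 : exp (-(u * (z - s))) = exp (-(u * z)) * exp (u * s) := by
      rw [← exp_add]; ring_nf
    have e2 : exp (-((1 - u) * s)) = exp (-s) * exp (u * s) := by
      rw [← exp_add]; ring_nf
    rw [e1, e2]; ring
  · intro y hy
    have : exp (-(u * y)) ≤ 1 := exp_le_one_iff.2 (by nlinarith [hu.1])
    nlinarith [hu.1, hu.2, exp_pos (-(u * y))]

lemma stepJ_g (t : ℝ) (ht : t ∈ Ioo (0 : ℝ) 1) (z : ℝ) (hz : 0 ≤ z) :
    stepJ (fun y => exp (-(t * y))) z ≤ ENNReal.ofReal (exp (-(t * z)) / (1 - t)) := by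
  have h1t : 1 - t ≠ 0 := by linarith [ht.2]
  rw [stepJ_eq _ (fun s => -(exp (-(t * z)) / (1 - t)) * exp (-((1 - t) * s))) (by fun_prop) _ z hz]
  · apply ENNReal.ofReal_le_ofReal
    have : 0 ≤ exp (-(t * z)) / (1 - t) := div_nonneg (exp_pos _).le (by linarith [ht.2])
    simp
    positivity
  · intro s
    have h2 : HasDerivAt (fun s : ℝ => exp (-((1 - t) * s)))
        (exp (-((1 - t) * s)) * (-((1 - t) * 1))) s :=
      ((hasDerivAt_id s).const_mul (1 - t)).neg.exp
    convert! (h2.const_mul (-(exp (-(t * z)) / (1 - t)))) using 1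
    have e1 : exp (-(t * (z - s))) = exp (-(t * z)) * exp (t * s) := by
      rw [← exp_add]; ring_nf
    have e2 : exp (-((1 - t) * s)) = exp (-s) * exp (t * s) := by
      rw [← exp_add]; ring_nf
    rw [e1, e2]; field_simp
  · intro y hy
    positivity

/-- Expected value of `g` of the distance to the line on the survival event. -/
noncomputable def survExp {Ω : Type*} [MeasureSpace Ω] (X : ℕ → Ω → ℝ) (x : ℝ) (n : ℕ)
    (G : ℝ → ENNReal) : ENNReal :=
  ∫⁻ ω, (survSet x n).indicator (fun v => G (n * x - ∑ j ∈ Finset.range n, v j))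
    (fun j => X j ω) ∂(ℙ : Measure Ω)

lemma survExp_mono {Ω : Type*} [MeasureSpace Ω] (X : ℕ → Ω → ℝ) (x : ℝ) (n : ℕ)
    (G H : ℝ → ENNReal) (h : ∀ y, 0 ≤ y → G y ≤ H y) : survExp X x n G ≤ survExp X x n H := by
  refine lintegral_mono fun ω => ?_
  refine indicator_le_indicator' fun hv => h _ ?_
  have := hv n le_rfl
  linarith

lemma survExp_succ {Ω : Type*} [MeasureSpace Ω] [IsProbabilityMeasure (ℙ : Measure Ω)]
    (X : ℕ → Ω → ℝ) (hmeas : ∀ i, Measurable (X i))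
    (hindep : iIndepFun X ℙ)
    (hdist : ∀ i, Measure.map (X i) ℙ = expMeasure 1) (x : ℝ) (n : ℕ) (g : ℝ → ℝ)
    (hg : Measurable g) :
    survExp X x (n + 1) (fun y => ENNReal.ofReal (g y)) =
      survExp X x n (fun y => stepJ g (y + x)) := by
  classical
  have := isProbabilityMeasure_expMeasure (r := 1) one_pos
  let ext : (Finset.range n → ℝ) → (ℕ → ℝ) :=
    fun v j => if h : j ∈ Finset.range n then v ⟨j, h⟩ else 0
  have hext : Measurable ext := by
    refine measurable_pi_lambda _ fun j => ?_
    by_cases h : j ∈ Finset.range n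
    · simp only [ext, h, dite_true]; fun_prop
    · simp only [ext, h, dite_false]; fun_prop
  have hI0 := hindep.indepFun_finset (Finset.range n) {n} (by simp) hmeas
  let V : Ω → ℕ → ℝ := fun ω => ext (fun j => X j ω)
  have hI : IndepFun V (X n) ℙ :=
    hI0.comp (φ := ext) (ψ := fun w : (({n} : Finset ℕ) → ℝ) => w ⟨n, by simp⟩) hext
      (measurable_pi_apply _)
  have hV : Measurable V := hext.comp (measurable_pi_lambda _ fun j => hmeas j)
  have hVj : ∀ ω, ∀ j < n, V ω j = X j ω := by
    intro ω j hj
    simp [V, ext, hj]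
  have hsum : ∀ ω, ∑ j ∈ Finset.range n, V ω j = ∑ j ∈ Finset.range n, X j ω := fun ω =>
    Finset.sum_congr rfl fun j hj => hVj ω j (Finset.mem_range.1 hj)
  have hmap := (indepFun_iff_map_prod_eq_prod_map_map hV.aemeasurable (hmeas n).aemeasurable).1 hI
  rw [hdist n] at hmap
  let z : (ℕ → ℝ) → ℝ := fun v => n * x - ∑ j ∈ Finset.range n, v j + x
  have hz : Measurable z := by fun_prop
  let K : (ℕ → ℝ) × ℝ → ENNReal := {p | p.1 ∈ survSet x n ∧ p.2 ≤ z p.1}.indicator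
    (fun p => ENNReal.ofReal (g (z p.1 - p.2)))
  have hK : Measurable K := by
    refine Measurable.indicator (by fun_prop) ?_
    exact (measurable_fst (measurableSet_survSet x n)).inter
      (measurableSet_le measurable_snd (hz.comp measurable_fst))
  have hKin : ∀ v, ∫⁻ s, K (v, s) ∂(expMeasure 1) =
      (survSet x n).indicator (fun v => stepJ g (z v)) v := by
    intro v
    by_cases hv : v ∈ survSet x n
    · rw [indicator_of_mem hv]
      refine lintegral_congr fun s => ?_
      simp [K, indicator, hv]
    · rw [indicator_of_notMem hv, ← lintegral_zero (μ := expMeasure 1)]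
      refine lintegral_congr fun s => ?_
      simp [K, hv]
  calc survExp X x (n + 1) (fun y => ENNReal.ofReal (g y))
      = ∫⁻ ω, K (V ω, X n ω) ∂ℙ := by
        refine lintegral_congr fun ω => ?_
        simp only [K, indicator, survSet_succ, mem_ofPred_eq, z, hsum,
          survSet_congr x n (V ω) (fun j => X j ω) (hVj ω)]
        split_ifs
        · congr 2
          rw [Finset.sum_range_succ]; push_cast; ring
        · rfl
    _ = ∫⁻ p, K p ∂(Measure.map (fun ω => (V ω, X n ω)) ℙ) :=
        (lintegral_map hK (hV.prodMk (hmeas n))).symm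
    _ = ∫⁻ v, ∫⁻ s, K (v, s) ∂(expMeasure 1) ∂(Measure.map V ℙ) := by
        rw [hmap, lintegral_prod _ hK.aemeasurable]
    _ = ∫⁻ ω, ∫⁻ s, K (V ω, s) ∂(expMeasure 1) ∂ℙ :=
        lintegral_map hK.lintegral_prod_right' hV
    _ = survExp X x n (fun y => stepJ g (y + x)) := by
        refine lintegral_congr fun ω => ?_
        rw [hKin]
        simp only [indicator, z, hsum,
          survSet_congr x n (V ω) (fun j => X j ω) (hVj ω)]

/-- Let `F_∞` be the CDF of `Z_∞ = sup{X̄_i : i ≥ 1}`, where the `X i` are i.i.d.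
exponential with mean 1. Then for every `u ∈ (0, 1)`, `F_∞(-log(1-u)/u) = u`;
that is, the inverse of the restriction of `F_∞` to `(1, ∞)` is
`u ↦ -log(1-u)/u`. -/
theorem supSampleMean_cdf_inverse
    {Ω : Type*} [MeasureSpace Ω] [IsProbabilityMeasure (ℙ : Measure Ω)]
    (X : ℕ → Ω → ℝ) (hmeas : ∀ i, Measurable (X i))
    (hindep : iIndepFun X ℙ)
    (hdist : ∀ i, Measure.map (X i) ℙ = expMeasure 1)
    (F : ℝ → ℝ)
    (hF : ∀ x : ℝ, F x =
      (ℙ {ω | ∀ i : ℕ, 1 ≤ i → (∑ j ∈ Finset.range i, X j ω) / i ≤ x}).toReal) :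
    ∀ u ∈ Ioo (0 : ℝ) 1, F (-Real.log (1 - u) / u) = u := by
  intro u hu
  obtain ⟨hu0, hu1⟩ := hu
  set x : ℝ := -Real.log (1 - u) / u with hx
  have hux : exp (-(u * x)) = 1 - u := by
    have : -(u * x) = Real.log (1 - u) := by rw [hx]; field_simp
    rw [this, exp_log (by linarith)]
  have hlog : Real.log (1 - u) ≤ 0 := Real.log_nonpos (by linarith) (by linarith)
  have hx0 : 0 ≤ x := div_nonneg (by linarith) hu0.le
  set t : ℝ := u / 2 with ht
  have htI : t ∈ Ioo (0 : ℝ) 1 := ⟨by linarith, by linarith⟩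
  set c : ℝ := exp (-(t * x)) / (1 - t) with hc
  have h1t : 0 < 1 - t := by linarith [htI.2]
  have hc0 : 0 ≤ c := by positivity
  have hc1 : c < 1 := by
    rw [hc, div_lt_one h1t]
    have hsq : exp (-(t * x)) ^ 2 = 1 - u := by
      rw [← hux, ← exp_nat_mul, ht]; push_cast; ring_nf
    refine lt_of_pow_lt_pow_left₀ 2 h1t.le ?_
    rw [hsq, ht]; nlinarith
  let h : ℝ → ℝ := fun y => 1 - (1 - u) * exp (-(u * y))
  let g : ℝ → ℝ := fun y => exp (-(t * y))
  have hA : ∀ n, survExp X x n (fun y => ENNReal.ofReal (h y)) = ENNReal.ofReal u := by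
    intro n
    induction n with
    | zero => simp [survExp, survSet, h]
    | succ n ih =>
      rw [survExp_succ X hmeas hindep hdist x n h (by fun_prop), ← ih]
      have key : ∀ y, 0 ≤ y → stepJ h (y + x) = ENNReal.ofReal (h y) := by
        intro y hy
        rw [stepJ_h u ⟨hu0, hu1⟩ _ (by linarith)]
        congr 2
        rw [← hux, ← exp_add]; ring_nf
      exact le_antisymm (survExp_mono _ _ _ _ _ fun y hy => (key y hy).le)
        (survExp_mono _ _ _ _ _ fun y hy => (key y hy).ge)
  have hB : ∀ n, survExp X x n (fun y => ENNReal.ofReal (g y)) ≤ ENNReal.ofReal (c ^ n) := by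
    intro n
    induction n with
    | zero => simp [survExp, survSet, g]
    | succ n ih =>
      rw [survExp_succ X hmeas hindep hdist x n g (by fun_prop)]
      calc survExp X x n (fun y => stepJ g (y + x))
          ≤ survExp X x n (fun y => ENNReal.ofReal c * ENNReal.ofReal (g y)) := by
            refine survExp_mono _ _ _ _ _ fun y hy => ?_
            refine (stepJ_g t htI _ (by linarith)).trans ?_
            rw [← ENNReal.ofReal_mul hc0]
            apply ENNReal.ofReal_le_ofReal
            apply le_of_eq
            have : exp (-(t * (y + x))) = exp (-(t * x)) * exp (-(t * y)) := by
              rw [← exp_add]; ring_nf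
            rw [hc, this]; ring
        _ = ENNReal.ofReal c * survExp X x n (fun y => ENNReal.ofReal (g y)) := by
            unfold survExp
            rw [← lintegral_const_mul' _ _ ENNReal.ofReal_ne_top]
            refine lintegral_congr fun ω => ?_
            simp only [indicator]
            split_ifs <;> simp
        _ ≤ ENNReal.ofReal (c ^ (n + 1)) := by
            rw [pow_succ', ENNReal.ofReal_mul hc0]
            gcongr
  let E : ℕ → Set Ω := fun n => (fun ω j => X j ω) ⁻¹' survSet x n
  have hEm : ∀ n, MeasurableSet (E n) := fun n =>
    (measurable_pi_lambda _ hmeas) (measurableSet_survSet x n)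
  have hP : ∀ n, ℙ (E n) = survExp X x n (fun _ => 1) := by
    intro n
    rw [← lintegral_indicator_one (hEm n)]
    rfl
  have hlow : ∀ n, ENNReal.ofReal u ≤ ℙ (E n) := by
    intro n
    rw [hP, ← hA n]
    refine survExp_mono _ _ _ _ _ fun y hy => ?_
    rw [ENNReal.ofReal_le_one]
    have := exp_pos (-(u * y))
    simp only [h]; nlinarith
  have hup : ∀ n, ℙ (E n) ≤ ENNReal.ofReal u + ENNReal.ofReal (c ^ n) := by
    intro n
    rw [hP]
    calc survExp X x n (fun _ => 1)
        ≤ survExp X x n (fun y => ENNReal.ofReal (h y) + ENNReal.ofReal (g y)) := by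
          refine survExp_mono _ _ _ _ _ fun y hy => ?_
          refine le_trans ?_ ENNReal.ofReal_add_le
          rw [ENNReal.one_le_ofReal]
          have h1 : exp (-(u * y)) ≤ exp (-(t * y)) := exp_le_exp.2 (by rw [ht]; nlinarith)
          have := exp_pos (-(u * y))
          simp only [h, g]; nlinarith
      _ = survExp X x n (fun y => ENNReal.ofReal (h y)) +
          survExp X x n (fun y => ENNReal.ofReal (g y)) := by
          unfold survExp
          rw [← lintegral_add_left]
          · refine lintegral_congr fun ω => ?_
            simp only [indicator]
            split_ifs <;> simp
          · refine Measurable.comp (g := (survSet x n).indicator _) ?_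
              (measurable_pi_lambda _ hmeas)
            exact Measurable.indicator (by fun_prop) (measurableSet_survSet x n)
      _ ≤ _ := by
          rw [hA]
          gcongr
          exact hB n
  have hanti : Antitone E := fun m n hmn ω hω i hi => hω i (hi.trans hmn)
  have hlim : Filter.Tendsto (fun n => ℙ (E n)) Filter.atTop (nhds (ℙ (⋂ n, E n))) :=
    tendsto_measure_iInter_atTop (fun n => (hEm n).nullMeasurableSet) hanti
      ⟨0, measure_ne_top _ _⟩
  have hlim2 : Filter.Tendsto (fun n => ℙ (E n)) Filter.atTop (nhds (ENNReal.ofReal u)) := by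
    refine tendsto_of_tendsto_of_tendsto_of_le_of_le tendsto_const_nhds ?_ hlow hup
    have h0 := ENNReal.tendsto_ofReal (tendsto_pow_atTop_nhds_zero_of_lt_one hc0 hc1)
    simpa using h0.const_add (ENNReal.ofReal u)
  have hset : {ω | ∀ i : ℕ, 1 ≤ i → (∑ j ∈ Finset.range i, X j ω) / i ≤ x} = ⋂ n, E n := by
    ext ω
    simp only [mem_ofPred_eq, mem_iInter]
    constructor
    · intro H n i _
      rcases Nat.eq_zero_or_pos i with rfl | hi
      · simp
      · have := H i hi
        rw [div_le_iff₀ (by exact_mod_cast hi)] at this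
        linarith
    · intro H i hi
      have := H i i le_rfl
      rw [div_le_iff₀ (by exact_mod_cast hi)]
      linarith
  rw [hF, hset, tendsto_nhds_unique hlim hlim2, ENNReal.toReal_ofReal hu0.le]
end

section
/- Let (X_i)_{i≥1} be i.i.d. exponential random variables with mean 1, X̄_i := (X_1 + ... + X_i)/i, Z_n := max{X̄_1, ..., X̄_n}, and F_n(x) := P(Z_n ≤ x). Then for every n ∈ ℕ⁺ and x ≥ 0, F_{n+1}(x) = F_n(x) − e^{−(n+1)x} · Vol(K_n(x)), where K_n(x) := { (y_1, ..., y_n) ∈ ℝ_+^n : y_1 + ... + y_i ≤ i x for all i = 1, ..., n } and Vol denotes n-dimensional Lebesgue measure (with the convention Vol(K_0(x)) = 1). -/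
open MeasureTheory ProbabilityTheory Real

lemma aux_lintegral_prod (n : ℕ) (f : Fin n → ℝ → ENNReal) (hf : ∀ i, Measurable (f i)) :
    ∫⁻ y : Fin n → ℝ, ∏ i, f i (y i) = ∏ i, ∫⁻ t, f i t := by
  induction n with
  | zero => simp [volume_pi]
  | succ n ih =>
    rw [← ((volume_preserving_piFinSuccAbove (fun _ : Fin (n + 1) => ℝ) 0).symm _).lintegral_comp_emb
      (MeasurableEquiv.measurableEmbedding _)]
    rw [Fin.prod_univ_succ, ← ih (fun i => f i.succ) (fun i => hf _)]
    rw [← lintegral_prod_mul (hf 0).aemeasurable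
      (Finset.measurable_fun_prod _ fun i _ => (hf i.succ).comp (measurable_pi_apply i)).aemeasurable]
    refine lintegral_congr fun p => ?_
    rw [Fin.prod_univ_succ]
    simp [MeasurableEquiv.piFinSuccAbove]

lemma aux_pi (n : ℕ) : Measure.pi (fun _ : Fin n => expMeasure 1) =
    (volume : Measure (Fin n → ℝ)).withDensity (fun y => ∏ i, exponentialPDF 1 (y i)) := by
  have : IsProbabilityMeasure (expMeasure 1) := isProbabilityMeasure_expMeasure one_pos
  have hm : Measurable (exponentialPDF 1) :=
    (measurable_exponentialPDFReal 1).ennreal_ofReal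
  refine Measure.pi_eq fun s hs => ?_
  have h2 : ∀ i, expMeasure 1 (s i) = ∫⁻ t, (s i).indicator (exponentialPDF 1) t := fun i => by
    rw [lintegral_indicator (hs i)]
    exact withDensity_apply _ (hs i)
  simp_rw [h2]
  rw [← aux_lintegral_prod n (fun i => (s i).indicator (exponentialPDF 1))
    (fun i => hm.indicator (hs i)), withDensity_apply _ (MeasurableSet.univ_pi hs),
    ← lintegral_indicator (MeasurableSet.univ_pi hs)]
  refine lintegral_congr fun y => ?_
  by_cases hy : y ∈ Set.univ.pi s
  · rw [Set.indicator_of_mem hy]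
    exact Finset.prod_congr rfl fun i _ => (Set.indicator_of_mem (hy i trivial) _).symm
  · rw [Set.indicator_of_notMem hy]
    simp only [Set.mem_pi, Set.mem_univ, true_imp_iff, not_forall] at hy
    obtain ⟨i, hi⟩ := hy
    exact (Finset.prod_eq_zero (Finset.mem_univ i) (Set.indicator_of_notMem hi _)).symm

lemma aux_tail (c : ℝ) (hc : 0 ≤ c) : expMeasure 1 (Set.Ioi c) = ENNReal.ofReal (exp (-c)) := by
  have : IsProbabilityMeasure (expMeasure 1) := isProbabilityMeasure_expMeasure one_pos
  have h1 := prob_compl_eq_one_sub (μ := expMeasure 1) (measurableSet_Iic (a := c))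
  have h2 : expMeasure 1 (Set.Iic c) = ENNReal.ofReal (1 - exp (-c)) := by
    have := lintegral_exponentialPDF_eq_antiDeriv one_pos c
    rw [if_pos hc, one_mul] at this
    rw [← this]
    exact withDensity_apply _ measurableSet_Iic
  rw [← Set.compl_Iic, h1, h2, ← ENNReal.ofReal_one, ← ENNReal.ofReal_sub _ (by simpa using hc)]
  simp

lemma aux_main (n : ℕ) (x : ℝ) (hx : 0 ≤ x) (B : Set (Fin n → ℝ)) (hB : MeasurableSet B)
    (hs : ∀ y ∈ B, ∑ j, y j ≤ n * x) :
    ((Measure.pi (fun _ : Fin n => expMeasure 1)).prod (expMeasure 1))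
      {p | p.1 ∈ B ∧ (n + 1) * x < ∑ j, p.1 j + p.2} =
    ENNReal.ofReal (exp (-((n + 1) * x))) * volume {y : Fin n → ℝ | (∀ j, 0 ≤ y j) ∧ y ∈ B} := by
  have : IsProbabilityMeasure (expMeasure 1) := isProbabilityMeasure_expMeasure one_pos
  have hm : Measurable (exponentialPDF 1) :=
    (measurable_exponentialPDFReal 1).ennreal_ofReal
  have hS : MeasurableSet {p : (Fin n → ℝ) × ℝ | p.1 ∈ B ∧ (n + 1) * x < ∑ j, p.1 j + p.2} :=
    (measurable_fst hB).inter (measurableSet_lt (f := fun _ => (n + 1) * x)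
      (g := fun p : (Fin n → ℝ) × ℝ => ∑ j, p.1 j + p.2) measurable_const (by fun_prop))
  have hK : MeasurableSet {y : Fin n → ℝ | (∀ j, 0 ≤ y j) ∧ y ∈ B} := by
    refine MeasurableSet.inter ?_ hB
    have : {y : Fin n → ℝ | ∀ j, 0 ≤ y j} = ⋂ j, {y | 0 ≤ y j} := by ext; simp
    change MeasurableSet {y : Fin n → ℝ | ∀ j, 0 ≤ y j}
    rw [this]
    exact MeasurableSet.iInter fun j => measurableSet_le measurable_const (by fun_prop)
  have hd : Measurable (fun y : Fin n → ℝ => ∏ i, exponentialPDF 1 (y i)) :=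
    Finset.measurable_fun_prod _ fun i _ => hm.comp (measurable_pi_apply i)
  rw [Measure.prod_apply hS, aux_pi, lintegral_withDensity_eq_lintegral_mul _ hd
    (measurable_measure_prodMk_left hS), ← lintegral_indicator_const hK]
  refine lintegral_congr fun y => ?_
  simp only [Pi.mul_apply]
  by_cases hy : ∀ j, 0 ≤ y j
  · by_cases hyB : y ∈ B
    · rw [Set.indicator_of_mem (show y ∈ {y : Fin n → ℝ | (∀ j, 0 ≤ y j) ∧ y ∈ B} from ⟨hy, hyB⟩)]
      have e : Prod.mk y ⁻¹' {p : (Fin n → ℝ) × ℝ | p.1 ∈ B ∧ (n + 1) * x < ∑ j, p.1 j + p.2}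
          = Set.Ioi ((n + 1) * x - ∑ j, y j) := by
        ext t
        simp only [Set.mem_preimage, Set.mem_setOf_eq, Set.mem_Ioi, hyB, true_and]
        constructor <;> intro h <;> linarith
      rw [e, aux_tail _ (by have := hs y hyB; nlinarith)]
      have e2 : ∏ i, exponentialPDF 1 (y i) = ENNReal.ofReal (exp (-∑ j, y j)) := by
        rw [← Finset.sum_neg_distrib, exp_sum, ENNReal.ofReal_prod_of_nonneg
          (fun i _ => (exp_pos _).le)]
        refine Finset.prod_congr rfl fun i _ => ?_
        rw [exponentialPDF_of_nonneg (hy i)]; simp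
      rw [e2, ← ENNReal.ofReal_mul (exp_pos _).le, ← exp_add]
      congr 2; ring
    · rw [Set.indicator_of_notMem (fun h => hyB h.2)]
      have e : Prod.mk y ⁻¹' {p : (Fin n → ℝ) × ℝ | p.1 ∈ B ∧ (n + 1) * x < ∑ j, p.1 j + p.2}
          = ∅ := by
        ext t; simp [hyB]
      rw [e]; simp
  · rw [Set.indicator_of_notMem (fun h => hy h.1)]
    push Not at hy
    obtain ⟨j, hj⟩ := hy
    rw [Finset.prod_eq_zero (Finset.mem_univ j) (exponentialPDF_of_neg hj), zero_mul]


/-- If `(X i)` are i.i.d. exponential random variables with mean 1,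
`Z_n = max{X̄_1, …, X̄_n}` and `F_n(x) = P(Z_n ≤ x)`, then for every `n ≥ 1` and
`x ≥ 0`, `F_{n+1}(x) = F_n(x) - e^{-(n+1)x}·Vol(K_n(x))`, where
`K_n(x) = {y ∈ ℝ₊ⁿ : y_1 + ⋯ + y_i ≤ i x for all i = 1, …, n}`. -/
theorem cdf_recursion_exponential
    {Ω : Type*} [MeasureSpace Ω] [IsProbabilityMeasure (ℙ : Measure Ω)]
    (X : ℕ → Ω → ℝ) (hmeas : ∀ i, Measurable (X i))
    (hindep : iIndepFun X ℙ)
    (hdist : ∀ i, Measure.map (X i) ℙ = expMeasure 1)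
    (F : ℕ → ℝ → ℝ)
    (hF : ∀ n x, F n x =
      (ℙ {ω | ∀ i ∈ Finset.Icc 1 n, (∑ j ∈ Finset.range i, X j ω) / i ≤ x}).toReal)
    (n : ℕ) (hn : 1 ≤ n) (x : ℝ) (hx : 0 ≤ x) :
    F (n + 1) x = F n x - Real.exp (-((n + 1) * x)) *
      (volume {y : Fin n → ℝ | (∀ j, 0 ≤ y j) ∧
        ∀ i : Fin n, ∑ j ∈ Finset.Iic i, y j ≤ ((i : ℕ) + 1) * x}).toReal := by
  have hP : IsProbabilityMeasure (expMeasure 1) := isProbabilityMeasure_expMeasure one_pos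
  set B : Set (Fin n → ℝ) := {y | ∀ i : Fin n, ∑ j ∈ Finset.Iic i, y j ≤ ((i : ℕ) + 1) * x}
    with hBdef
  have hB : MeasurableSet B := by
    have : B = ⋂ i : Fin n, {y | ∑ j ∈ Finset.Iic i, y j ≤ ((i : ℕ) + 1) * x} := by
      ext; simp [hBdef]
    rw [this]
    exact MeasurableSet.iInter fun j => measurableSet_le (by fun_prop) measurable_const
  have hs : ∀ y ∈ B, ∑ j, y j ≤ n * x := by
    intro y hy
    have h := hy ⟨n - 1, by omega⟩
    have e : Finset.Iic (⟨n - 1, by omega⟩ : Fin n) = Finset.univ := by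
      ext j; simp [Fin.le_def]; omega
    rw [e] at h
    have e2 : ((n - 1 : ℕ) : ℝ) + 1 = n := by
      exact_mod_cast Nat.sub_add_cancel hn
    simpa [e2] using h
  set Y : Ω → Fin n → ℝ := fun ω i => X i ω with hY
  have hYm : Measurable Y := measurable_pi_lambda _ fun i => hmeas i
  have hYlaw : Measure.map Y ℙ = Measure.pi (fun _ : Fin n => expMeasure 1) := by
    have h := (hindep.precomp (g := fun i : Fin n => (i : ℕ)) Fin.val_injective)
    have h' := (iIndepFun_iff_map_fun_eq_pi_map (fun i : Fin n => (hmeas i).aemeasurable)).1 h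
    simp only [hdist] at h'
    exact h'
  have hYX : IndepFun Y (X n) ℙ := by
    have h := hindep.indepFun_finset (Finset.range n) {n} (by simp) hmeas
    exact h.comp (φ := fun (z : Finset.range n → ℝ) (i : Fin n) => z ⟨i, by simp⟩)
      (ψ := fun (z : ({n} : Finset ℕ) → ℝ) => z ⟨n, by simp⟩) (by fun_prop) (by fun_prop)
  have hjoint : Measure.map (fun ω => (Y ω, X n ω)) ℙ =
      (Measure.pi (fun _ : Fin n => expMeasure 1)).prod (expMeasure 1) := by
    rw [(indepFun_iff_map_prod_eq_prod_map_map hYm.aemeasurable (hmeas n).aemeasurable).1 hYX,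
      hYlaw, hdist]
  set A : ℕ → Set Ω := fun m =>
    {ω | ∀ i ∈ Finset.Icc 1 m, (∑ j ∈ Finset.range i, X j ω) / i ≤ x} with hA
  have hAm : ∀ m, MeasurableSet (A m) := by
    intro m
    have : A m = ⋂ i ∈ Finset.Icc 1 m, {ω | (∑ j ∈ Finset.range i, X j ω) / i ≤ x} := by
      ext; simp [hA]
    rw [this]
    exact Finset.measurableSet_biInter _ fun i _ =>
      measurableSet_le (by fun_prop) measurable_const
  have hsub : A (n + 1) ⊆ A n := fun ω h i hi =>
    h i (Finset.Icc_subset_Icc_right (Nat.le_succ n) hi)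
  have hAB : ∀ ω, ω ∈ A n ↔ Y ω ∈ B := by
    intro ω
    have key : ∀ i : Fin n, ∑ j ∈ Finset.Iic i, Y ω j = ∑ j ∈ Finset.range (i + 1), X j ω := by
      intro i
      have : Finset.range ((i : ℕ) + 1) = (Finset.Iic i).map Fin.valEmbedding := by
        rw [Fin.map_valEmbedding_Iic]; ext; simp [Nat.lt_succ_iff]
      rw [this, Finset.sum_map]; rfl
    simp only [hA, hBdef, Set.mem_setOf_eq, key]
    constructor
    · intro h i
      have := h (i + 1) (by simp)
      rw [div_le_iff₀ (by positivity)] at this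
      push_cast at this
      linarith
    · intro h i hi
      rw [Finset.mem_Icc] at hi
      have := h ⟨i - 1, by omega⟩
      have e : i - 1 + 1 = i := by omega
      have e2 : ((i - 1 : ℕ) : ℝ) + 1 = i := by exact_mod_cast e
      simp only [e, e2] at this
      rw [div_le_iff₀ (by exact_mod_cast hi.1)]
      linarith
  have hdiff : A n \ A (n + 1) = (fun ω => (Y ω, X n ω)) ⁻¹'
      {p | p.1 ∈ B ∧ (n + 1) * x < ∑ j, p.1 j + p.2} := by
    ext ω
    have hsum : ∑ j, Y ω j + X n ω = ∑ j ∈ Finset.range (n + 1), X j ω := by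
      rw [Finset.sum_range_succ, Finset.sum_range]
    simp only [Set.mem_diff, Set.mem_preimage, Set.mem_setOf_eq, hsum, ← hAB]
    refine and_congr_right fun h => ?_
    have hiff : ω ∈ A (n + 1) ↔ (∑ j ∈ Finset.range (n + 1), X j ω) ≤ (n + 1) * x := by
      have e : (∑ j ∈ Finset.range (n + 1), X j ω) / ((n + 1 : ℕ) : ℝ) ≤ x ↔
          (∑ j ∈ Finset.range (n + 1), X j ω) ≤ (n + 1) * x := by
        rw [div_le_iff₀ (by positivity)]; push_cast; rw [mul_comm]
      rw [← e]
      constructor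
      · intro h'
        exact h' (n + 1) (by simp)
      · intro h' i hi
        rw [Finset.mem_Icc] at hi
        rcases Nat.lt_or_ge n i with h1 | h1
        · obtain rfl : i = n + 1 := by omega
          exact h'
        · exact h i (Finset.mem_Icc.2 ⟨hi.1, h1⟩)
    rw [hiff, not_le]
  have hS : MeasurableSet {p : (Fin n → ℝ) × ℝ | p.1 ∈ B ∧ (n + 1) * x < ∑ j, p.1 j + p.2} :=
    (measurable_fst hB).inter (measurableSet_lt (f := fun _ => (n + 1) * x)
      (g := fun p : (Fin n → ℝ) × ℝ => ∑ j, p.1 j + p.2) measurable_const (by fun_prop))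
  have hmain : ℙ (A n \ A (n + 1)) = ENNReal.ofReal (exp (-((n + 1) * x))) *
      volume {y : Fin n → ℝ | (∀ j, 0 ≤ y j) ∧ y ∈ B} := by
    rw [hdiff, ← Measure.map_apply (hYm.prodMk (hmeas n)) hS, hjoint, aux_main n x hx B hB hs]
  have hreal := measureReal_diff (μ := (ℙ : Measure Ω)) hsub (hAm (n + 1))
  have h3 : (ℙ : Measure Ω).real (A n \ A (n + 1)) = exp (-((n + 1) * x)) *
      (volume {y : Fin n → ℝ | (∀ j, 0 ≤ y j) ∧ y ∈ B}).toReal := by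
    rw [measureReal_def, hmain, ENNReal.toReal_mul, ENNReal.toReal_ofReal (exp_pos _).le]
  rw [hF, hF]
  change (ℙ : Measure Ω).real (A (n + 1)) = (ℙ : Measure Ω).real (A n) - exp (-((n + 1) * x)) *
      (volume {y : Fin n → ℝ | (∀ j, 0 ≤ y j) ∧ y ∈ B}).toReal
  linarith
end

section
/- Let (X_i)_{i≥1} be i.i.d. random variables with mean 0, variance 1, and E|X_1|^p < ∞ for some p > 2. Let X̄_i := (X_1 + ... + X_i)/i and M_n := sup{X̄_i : i ≥ n}. Then √n · M_n converges in distribution, as n → ∞, to |Z|, where Z is a standard normal random variable. -/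
open MeasureTheory ProbabilityTheory Real Filter


section SupMean
variable {Ω : Type*}

/-- The event that the process stays below `1` on the window `[n, N]`. -/
def stayBelow (Z : ℕ → Ω → ℝ) (n N : ℕ) : Set Ω := {ω | ∀ k, n ≤ k → k ≤ N → Z k ω ≤ 1}

lemma stayBelow_succ_subset (Z : ℕ → Ω → ℝ) (n N : ℕ) :
    stayBelow Z n (N + 1) ⊆ stayBelow Z n N :=
  fun _ h k h1 h2 => h k h1 (by omega)

lemma stayBelow_eq_iInter (Z : ℕ → Ω → ℝ) (n N : ℕ) :
    stayBelow Z n N = ⋂ k ∈ Finset.Icc n N, {ω | Z k ω ≤ 1} := by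
  ext ω; simp [stayBelow]

lemma measurableSet_stayBelow {m : MeasurableSpace Ω} {Z : ℕ → Ω → ℝ} {n N : ℕ}
    (hZ : ∀ k, k ≤ N → Measurable[m] (Z k)) :
    MeasurableSet[m] (stayBelow Z n N) := by
  rw [stayBelow_eq_iInter]
  refine Finset.measurableSet_biInter _ fun k hk => ?_
  exact measurableSet_le (hZ k (Finset.mem_Icc.1 hk).2) measurable_const

lemma stayBelow_self (Z : ℕ → Ω → ℝ) (n : ℕ) : stayBelow Z n n = {ω | Z n ω ≤ 1} := by
  ext ω
  simp only [stayBelow, Set.mem_ofPred_eq]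
  exact ⟨fun h => h n le_rfl le_rfl, fun h k h1 h2 => by rwa [le_antisymm h2 h1]⟩

variable [MeasurableSpace Ω] {μ : Measure Ω} [IsProbabilityMeasure μ]

lemma integral_ite_eq {A : Set Ω} (hA : MeasurableSet A) {f : Ω → ℝ} (hf : Integrable f μ)
    (c : ℝ) :
    ∫ ω, (A.indicator f ω + Aᶜ.indicator (fun _ => c) ω) ∂μ
      = ∫ ω in A, f ω ∂μ + c * μ.real Aᶜ := by
  rw [integral_add (hf.indicator hA) ((integrable_const c).indicator hA.compl),
    integral_indicator hA, integral_indicator hA.compl]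
  simp [mul_comm]

lemma maximal_upper {Z : ℕ → Ω → ℝ} (hZ : ∀ k, Measurable (Z k))
    (hInt : ∀ k, Integrable (Z k) μ) (h0 : ∀ k ω, 0 ≤ Z k ω) {q : ℝ} (hq : 1 ≤ q) {n : ℕ}
    (hstep : ∀ N, n ≤ N → ∫ ω in stayBelow Z n N, Z (N + 1) ω ∂μ
      ≤ q * ∫ ω in stayBelow Z n N, Z N ω ∂μ) (m : ℕ) :
    ∫ ω in stayBelow Z n (n + m), Z (n + m) ω ∂μ + 1 * μ.real (stayBelow Z n (n + m))ᶜ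
      ≤ q ^ m * ∫ ω, min 1 (Z n ω) ∂μ := by
  have hB : ∀ N, MeasurableSet (stayBelow Z n N) := fun N =>
    measurableSet_stayBelow fun k _ => hZ k
  induction m with
  | zero =>
    rw [Nat.add_zero, ← integral_ite_eq (hB n) (hInt n), pow_zero, one_mul]
    refine le_of_eq (integral_congr_ae (ae_of_all _ fun ω => ?_))
    simp only [Set.indicator_apply, Set.mem_compl_iff, stayBelow_self, Set.mem_ofPred_eq]
    split_ifs with h
    · simp [h]
    · simp [le_of_not_ge h]
  | succ m ih =>
    have hs := hstep (n + m) (by omega)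
    have key : ∫ ω in stayBelow Z n (n + m + 1), Z (n + m + 1) ω ∂μ
          + 1 * μ.real (stayBelow Z n (n + m + 1))ᶜ
        ≤ ∫ ω in stayBelow Z n (n + m), Z (n + m + 1) ω ∂μ
          + 1 * μ.real (stayBelow Z n (n + m))ᶜ := by
      rw [← integral_ite_eq (hB _) (hInt _), ← integral_ite_eq (hB _) (hInt _)]
      refine integral_mono_ae (((hInt _).indicator (hB _)).add
        ((integrable_const _).indicator (hB _).compl)) (((hInt _).indicator (hB _)).add
        ((integrable_const _).indicator (hB _).compl)) (ae_of_all _ fun ω => ?_)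
      classical
      simp only [Set.indicator_apply, Set.mem_compl_iff]
      by_cases h1 : ω ∈ stayBelow Z n (n + m + 1)
      · have h2 := stayBelow_succ_subset _ _ _ h1
        simp [h1, h2]
      · by_cases h2 : ω ∈ stayBelow Z n (n + m)
        · simp only [h1, h2, if_true, if_false, not_true, not_false_iff, zero_add, add_zero]
          by_contra h3
          apply h1
          intro k hk1 hk2
          rcases Nat.lt_or_ge k (n + m + 1) with h | h
          · exact h2 k hk1 (by omega)
          · have : k = n + m + 1 := by omega
            subst this; linarith
        · simp [h1, h2]
    have hi0 : 0 ≤ ∫ ω in stayBelow Z n (n + m), Z (n + m) ω ∂μ :=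
      integral_nonneg fun ω => h0 _ _
    have hm0 : 0 ≤ μ.real (stayBelow Z n (n + m))ᶜ := measureReal_nonneg
    calc _ ≤ _ := key
      _ ≤ q * (∫ ω in stayBelow Z n (n + m), Z (n + m) ω ∂μ
          + 1 * μ.real (stayBelow Z n (n + m))ᶜ) := by nlinarith
      _ ≤ q * (q ^ m * ∫ ω, min 1 (Z n ω) ∂μ) := by gcongr
      _ = _ := by ring

lemma maximal_lower {Z : ℕ → Ω → ℝ} (hZ : ∀ k, Measurable (Z k))
    (hInt : ∀ k, Integrable (Z k) μ) (h0 : ∀ k ω, 0 ≤ Z k ω) {q K : ℝ} (hq0 : 0 ≤ q)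
    (hq : q ≤ 1) (hK1 : 1 ≤ K) (hK : ∀ k ω, Z k ω ≤ 1 → Z (k + 1) ω ≤ K) {n : ℕ}
    (hstep : ∀ N, n ≤ N → q * ∫ ω in stayBelow Z n N, Z N ω ∂μ
      ≤ ∫ ω in stayBelow Z n N, Z (N + 1) ω ∂μ) (m : ℕ) :
    q ^ m * ∫ ω, min 1 (Z n ω) ∂μ ≤
    ∫ ω in stayBelow Z n (n + m), Z (n + m) ω ∂μ + K * μ.real (stayBelow Z n (n + m))ᶜ := by
  have hB : ∀ N, MeasurableSet (stayBelow Z n N) := fun N =>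
    measurableSet_stayBelow fun k _ => hZ k
  induction m with
  | zero =>
    rw [Nat.add_zero, ← integral_ite_eq (hB n) (hInt n), pow_zero, one_mul]
    refine integral_mono_of_nonneg (ae_of_all _ fun ω => le_min zero_le_one (h0 _ _))
      (((hInt _).indicator (hB _)).add
        ((integrable_const _).indicator (hB _).compl)) (ae_of_all _ fun ω => ?_)
    simp only [Set.indicator_apply, Set.mem_compl_iff, stayBelow_self, Set.mem_ofPred_eq]
    split_ifs with h
    · simp
    · simp [hK1]
  | succ m ih =>
    have hs := hstep (n + m) (by omega)
    have key : ∫ ω in stayBelow Z n (n + m), Z (n + m + 1) ω ∂μ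
          + K * μ.real (stayBelow Z n (n + m))ᶜ
        ≤ ∫ ω in stayBelow Z n (n + m + 1), Z (n + m + 1) ω ∂μ
          + K * μ.real (stayBelow Z n (n + m + 1))ᶜ := by
      rw [← integral_ite_eq (hB _) (hInt _), ← integral_ite_eq (hB _) (hInt _)]
      refine integral_mono_ae (((hInt _).indicator (hB _)).add
        ((integrable_const _).indicator (hB _).compl)) (((hInt _).indicator (hB _)).add
        ((integrable_const _).indicator (hB _).compl)) (ae_of_all _ fun ω => ?_)
      classical
      simp only [Set.indicator_apply, Set.mem_compl_iff]
      by_cases h1 : ω ∈ stayBelow Z n (n + m + 1)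
      · have h2 := stayBelow_succ_subset _ _ _ h1
        simp [h1, h2]
      · by_cases h2 : ω ∈ stayBelow Z n (n + m)
        · simp only [h1, h2, if_true, if_false, not_true, not_false_iff, zero_add, add_zero]
          exact hK _ _ (h2 (n + m) (by omega) le_rfl)
        · simp [h1, h2]
    have hi0 : 0 ≤ ∫ ω in stayBelow Z n (n + m), Z (n + m) ω ∂μ :=
      integral_nonneg fun ω => h0 _ _
    have hm0 : 0 ≤ K * μ.real (stayBelow Z n (n + m))ᶜ :=
      mul_nonneg (by linarith) measureReal_nonneg
    calc _ = q * (q ^ m * ∫ ω, min 1 (Z n ω) ∂μ) := by ring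
      _ ≤ q * (∫ ω in stayBelow Z n (n + m), Z (n + m) ω ∂μ
          + K * μ.real (stayBelow Z n (n + m))ᶜ) := by gcongr
      _ ≤ ∫ ω in stayBelow Z n (n + m), Z (n + m + 1) ω ∂μ
          + K * μ.real (stayBelow Z n (n + m))ᶜ := by nlinarith
      _ ≤ _ := key

lemma setIntegral_stayBelow_le {Z : ℕ → Ω → ℝ} (hZ : ∀ k, Measurable (Z k))
    (hInt : ∀ k, Integrable (Z k) μ) (h0 : ∀ k ω, 0 ≤ Z k ω) {n N : ℕ} (hn : n ≤ N) :
    ∫ ω in stayBelow Z n N, Z N ω ∂μ ≤ ∫ ω, min 1 (Z N ω) ∂μ := by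
  have hB : MeasurableSet (stayBelow Z n N) := measurableSet_stayBelow fun k _ => hZ k
  rw [← integral_indicator hB]
  refine integral_mono ((hInt _).indicator hB) ((integrable_const _).inf (hInt _)) fun ω => ?_
  classical
  simp only [Set.indicator_apply]
  split_ifs with h
  · exact le_min (h N hn le_rfl) le_rfl
  · exact le_min zero_le_one (h0 _ _)

/-- Independence of the past and the next variable. -/
lemma integral_past_mul {X : ℕ → Ω → ℝ} (hX : ∀ i, Measurable (X i)) (hindep : iIndepFun X μ)
    (hident : ∀ i, IdentDistrib (X i) (X 0) μ μ) {N : ℕ} {f : Ω → ℝ}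
    (hf : Measurable[Filtration.natural X (fun i => (hX i).stronglyMeasurable) N] f)
    {g : ℝ → ℝ} (hg : Measurable g) :
    ∫ ω, f ω * g (X (N + 1) ω) ∂μ = (∫ ω, f ω ∂μ) * ∫ ω, g (X 0 ω) ∂μ := by
  have h1 := hindep.indep_comap_natural_of_lt (fun i => (hX i).stronglyMeasurable)
    (Nat.lt_succ_self N)
  have h2 : IndepFun f (fun ω => g (X (N + 1) ω)) μ := by
    rw [IndepFun_iff_Indep]
    refine indep_of_indep_of_le_left (indep_of_indep_of_le_right h1.symm ?_) hf.comap_le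
    rw [show (fun ω => g (X (N + 1) ω)) = g ∘ X (N + 1) from rfl, ← MeasurableSpace.comap_comp]
    exact MeasurableSpace.comap_mono hg.comap_le
  have hfm : Measurable f := hf.mono (Filtration.le _ _) le_rfl
  have := h2.integral_mul_eq_mul_integral hfm.aestronglyMeasurable
    (hg.comp (hX _)).aestronglyMeasurable
  have h3 : ∫ ω, g (X (N + 1) ω) ∂μ = ∫ ω, g (X 0 ω) ∂μ := ((hident (N + 1)).comp hg).integral_eq
  rw [← h3]
  exact this

lemma measurable_natural {X : ℕ → Ω → ℝ} (hX : ∀ i, Measurable (X i)) {j N : ℕ} (h : j ≤ N) :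
    Measurable[Filtration.natural X (fun i => (hX i).stronglyMeasurable) N] (X j) :=
  Measurable.mono (comap_measurable (X j))
    (le_iSup₂_of_le (f := fun j (_ : j ≤ N) => MeasurableSpace.comap (X j) _) j h
      (by exact le_rfl)) le_rfl

end SupMean


section GaussPart

/-- The limiting crossing probability. -/
noncomputable def crossProb (x : ℝ) : ℝ :=
  ∫ y, min 1 (Real.exp (2 * x * y - 2 * x ^ 2)) ∂(gaussianReal 0 1)

lemma crossProb_eq {x : ℝ} (hx : 0 ≤ x) :
    crossProb x = 1 - (gaussianReal 0 1 {y : ℝ | |y| ≤ x}).toReal := by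
  have hInt : Integrable (fun y => min 1 (Real.exp (2 * x * y - 2 * x ^ 2))) (gaussianReal 0 1) := by
    refine Integrable.of_bound (C := 1) (by fun_prop) (ae_of_all _ fun y => ?_)
    rw [Real.norm_eq_abs, abs_of_nonneg (le_min zero_le_one (Real.exp_pos _).le)]
    exact min_le_left _ _
  have hna : NullSingletonClass (gaussianReal 0 1) := nullSingletonClass_gaussianReal one_ne_zero
  have h1 : ∫ y in Set.Ioi x, min 1 (Real.exp (2 * x * y - 2 * x ^ 2)) ∂(gaussianReal 0 1)
      = (gaussianReal 0 1).real (Set.Ioi x) := by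
    rw [← integral_indicator_one measurableSet_Ioi, ← integral_indicator measurableSet_Ioi]
    congr 1
    ext y
    by_cases hy : y ∈ Set.Ioi x
    · have hy' : x < y := hy
      simp only [hy, Set.indicator_of_mem, Pi.one_apply]
      apply min_eq_left
      apply Real.one_le_exp
      nlinarith
    · simp [hy]
  have h2 : ∫ y in Set.Iic x, min 1 (Real.exp (2 * x * y - 2 * x ^ 2)) ∂(gaussianReal 0 1)
      = (gaussianReal 0 1).real (Set.Iio (-x)) := by
    have e1 : (gaussianReal 0 1).real (Set.Iio (-x)) = (gaussianReal (2 * x) 1).real (Set.Iic x) := by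
      have : gaussianReal (2 * x) 1 = (gaussianReal 0 1).map (· + 2 * x) := by
        rw [gaussianReal_map_add_const, zero_add]
      rw [this, map_measureReal_apply (by fun_prop) measurableSet_Iic]
      rw [measureReal_def, measureReal_def, measure_congr (Iio_ae_eq_Iic (μ := gaussianReal 0 1))]
      congr 2
      ext y
      simp only [Set.mem_Iic, Set.mem_preimage]
      constructor <;> intro h <;> linarith
    rw [e1, measureReal_def, gaussianReal_apply_eq_integral _ one_ne_zero,
      ENNReal.toReal_ofReal (integral_nonneg fun y => gaussianPDFReal_nonneg _ _ _),
      ← integral_indicator measurableSet_Iic, ← integral_indicator measurableSet_Iic,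
      integral_gaussianReal_eq_integral_smul one_ne_zero]
    congr 1
    ext y
    by_cases hy : y ∈ Set.Iic x
    · have hy' : y ≤ x := hy
      simp only [hy, Set.indicator_of_mem, smul_eq_mul]
      rw [min_eq_right (Real.exp_le_one_iff.2 (by nlinarith))]
      simp only [gaussianPDFReal, NNReal.coe_one, mul_assoc]
      rw [← Real.exp_add]
      congr 2
      ring
    · simp [hy]
  have h3 : {y : ℝ | |y| ≤ x} = (Set.Iio (-x) ∪ Set.Ioi x)ᶜ := by
    ext y
    simp [abs_le]
  have h4 : (gaussianReal 0 1 {y : ℝ | |y| ≤ x}).toReal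
      = 1 - ((gaussianReal 0 1).real (Set.Iio (-x)) + (gaussianReal 0 1).real (Set.Ioi x)) := by
    rw [h3, ← measureReal_def, probReal_compl_eq_one_sub (measurableSet_Iio.union measurableSet_Ioi),
      measureReal_union _ measurableSet_Ioi]
    rw [Set.disjoint_left]
    intro y h h'
    simp at h h'
    linarith
  rw [crossProb, ← integral_add_compl measurableSet_Iic hInt, Set.compl_Iic, h1, h2, h4]
  ring

lemma min_one_exp_mem (z : ℝ) : ‖min 1 (Real.exp z)‖ ≤ 1 := by
  rw [Real.norm_eq_abs, abs_of_nonneg (le_min zero_le_one (Real.exp_pos _).le)]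
  exact min_le_left _ _

lemma continuous_crossProb : Continuous crossProb := by
  refine continuous_of_dominated (bound := fun _ => 1) (fun x => by fun_prop)
    (fun x => ae_of_all _ fun y => min_one_exp_mem _) (integrable_const _)
    (ae_of_all _ fun y => by fun_prop)

lemma crossProb_zero : crossProb 0 = 1 := by simp [crossProb]

lemma tendsto_crossProb_atTop : Tendsto crossProb atTop (nhds 0) := by
  have : (0 : ℝ) = ∫ y : ℝ, (0 : ℝ) ∂(gaussianReal 0 1) := by simp
  rw [this]
  refine tendsto_integral_filter_of_dominated_convergence (fun _ => 1)
    (Eventually.of_forall fun x => by fun_prop)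
    (Eventually.of_forall fun x => ae_of_all _ fun y => min_one_exp_mem _) (integrable_const _)
    (ae_of_all _ fun y => ?_)
  have h1 : Tendsto (fun x : ℝ => Real.exp (2 * x * y - 2 * x ^ 2)) atTop (nhds 0) := by
    apply Real.tendsto_exp_atBot.comp
    have : (fun x : ℝ => 2 * x * y - 2 * x ^ 2) = fun x => x * (2 * y - 2 * x) := by ext x; ring
    rw [this]
    apply tendsto_id.atTop_mul_atBot₀
    apply tendsto_atBot_add_const_left
    apply tendsto_neg_atTop_atBot.comp
    exact tendsto_id.const_mul_atTop (by norm_num)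
  refine tendsto_of_tendsto_of_tendsto_of_le_of_le tendsto_const_nhds h1
    (fun x => le_min zero_le_one (Real.exp_pos _).le) (fun x => min_le_right _ _)

variable {Ω : Type*} [MeasurableSpace Ω] {μ : Measure Ω} [IsProbabilityMeasure μ]

lemma clt_crossProb {X : ℕ → Ω → ℝ} (hindep : iIndepFun X μ)
    (hident : ∀ i, IdentDistrib (X i) (X 0) μ μ) (h0 : ∫ ω, X 0 ω ∂μ = 0)
    (h1 : ∫ ω, X 0 ω ^ 2 ∂μ = 1) (x : ℝ) :
    Tendsto (fun n : ℕ => ∫ ω, min 1 (Real.exp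
      (2 * x * ((√n)⁻¹ * ∑ k ∈ Finset.range n, X k ω) - 2 * x ^ 2)) ∂μ) atTop
      (nhds (crossProb x)) := by
  have hY : HasLaw id (gaussianReal 0 1) (gaussianReal 0 1) := HasLaw.id
  have h := (tendstoInDistribution_inv_sqrt_mul_sum (P := μ) hY h0 (by simpa using h1)
    hindep hident)
  let g : BoundedContinuousFunction ℝ ℝ := BoundedContinuousFunction.ofNormedAddCommGroup
    (fun y => min 1 (Real.exp (2 * x * y - 2 * x ^ 2))) (by fun_prop) 1
    (fun y => min_one_exp_mem _)
  have h2 := (ProbabilityMeasure.tendsto_iff_forall_integral_tendsto.1 h.tendsto) g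
  have hgc : Continuous (fun y => min 1 (Real.exp (2 * x * y - 2 * x ^ 2))) := by fun_prop
  convert h2 using 2
  · rename_i n
    symm
    exact integral_map (h.forall_aemeasurable n) hgc.aestronglyMeasurable
  · symm
    simp only [crossProb]
    have := integral_map (μ := gaussianReal 0 1) (φ := id) aemeasurable_id
      (f := g) (g.continuous.aestronglyMeasurable)
    exact this

end GaussPart


section TailPart
variable {Ω : Type*} [MeasurableSpace Ω] {μ : Measure Ω} [IsProbabilityMeasure μ]

lemma measurable_sum_natural {X : ℕ → Ω → ℝ} (hX : ∀ i, Measurable (X i)) {k N : ℕ}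
    (h : k ≤ N + 1) {g : ℝ → ℝ} (hg : Measurable g) :
    Measurable[Filtration.natural X (fun i => (hX i).stronglyMeasurable) N]
      (fun ω => ∑ j ∈ Finset.range k, g (X j ω)) := by
  refine Finset.measurable_fun_sum _ fun j hj => ?_
  exact hg.comp (measurable_natural hX (by have := Finset.mem_range.1 hj; omega))

lemma integral_sq_step {X : ℕ → Ω → ℝ} (hX : ∀ i, Measurable (X i)) (hindep : iIndepFun X μ)
    (hident : ∀ i, IdentDistrib (X i) (X 0) μ μ) (h0 : ∫ ω, X 0 ω ∂μ = 0)
    (h1 : ∫ ω, X 0 ω ^ 2 ∂μ = 1) (hL2 : ∀ i, MemLp (X i) 2 μ) {N : ℕ} {B : Set Ω}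
    (hB : MeasurableSet[Filtration.natural X (fun i => (hX i).stronglyMeasurable) N] B) :
    ∫ ω in B, (∑ j ∈ Finset.range (N + 1 + 1), X j ω) ^ 2 ∂μ
      = ∫ ω in B, (∑ j ∈ Finset.range (N + 1), X j ω) ^ 2 ∂μ + μ.real B := by
  have hBm : MeasurableSet B := Filtration.le _ _ _ hB
  have hS : MemLp (fun ω => ∑ j ∈ Finset.range (N + 1), X j ω) 2 μ :=
    memLp_finsetSum _ fun j _ => hL2 j
  have hSm := measurable_sum_natural hX (le_refl (N + 1)) measurable_id
  simp only [id] at hSm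
  have i1 : Integrable (fun ω => (∑ j ∈ Finset.range (N + 1), X j ω) ^ 2) μ := hS.integrable_sq
  have i2 : Integrable (fun ω => (∑ j ∈ Finset.range (N + 1), X j ω) * X (N + 1) ω) μ :=
    hS.integrable_mul (hL2 _)
  have i3 : Integrable (fun ω => X (N + 1) ω ^ 2) μ := (hL2 _).integrable_sq
  have e2 : ∫ ω in B, (∑ j ∈ Finset.range (N + 1), X j ω) * X (N + 1) ω ∂μ = 0 := by
    have := integral_past_mul hX hindep hident (hSm.indicator hB) measurable_id
    simp only [id, h0, mul_zero] at this
    rw [← integral_indicator hBm, ← this]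
    congr 1
    ext ω
    by_cases hω : ω ∈ B <;> simp [hω]
  have e3 : ∫ ω in B, X (N + 1) ω ^ 2 ∂μ = μ.real B := by
    have := integral_past_mul hX hindep hident
      ((@measurable_const ℝ Ω _ (Filtration.natural X (fun i => (hX i).stronglyMeasurable) N)
        1).indicator hB)
      (measurable_id.pow_const 2)
    simp only [id, h1, mul_one] at this
    rw [integral_indicator hBm] at this
    simp only [integral_const, smul_eq_mul, mul_one, measureReal_restrict_apply_univ] at this
    rw [← integral_indicator hBm, ← this]
    congr 1
    ext ω
    by_cases hω : ω ∈ B <;> simp [hω]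
  have : ∀ ω, (∑ j ∈ Finset.range (N + 1 + 1), X j ω) ^ 2
      = ((∑ j ∈ Finset.range (N + 1), X j ω) ^ 2
        + 2 * ((∑ j ∈ Finset.range (N + 1), X j ω) * X (N + 1) ω)) + X (N + 1) ω ^ 2 := by
    intro ω
    rw [Finset.sum_range_succ]; ring
  simp_rw [this]
  have i12 : Integrable (fun ω => (∑ j ∈ Finset.range (N + 1), X j ω) ^ 2
        + 2 * ((∑ j ∈ Finset.range (N + 1), X j ω) * X (N + 1) ω)) μ := i1.add (i2.const_mul 2)
  rw [integral_add i12.integrableOn i3.integrableOn,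
    integral_add i1.integrableOn (i2.const_mul 2).integrableOn, integral_const_mul, e2, e3]
  ring

lemma integral_sum_sq {X : ℕ → Ω → ℝ} (hX : ∀ i, Measurable (X i)) (hindep : iIndepFun X μ)
    (hident : ∀ i, IdentDistrib (X i) (X 0) μ μ) (h0 : ∫ ω, X 0 ω ∂μ = 0)
    (h1 : ∫ ω, X 0 ω ^ 2 ∂μ = 1) (hL2 : ∀ i, MemLp (X i) 2 μ) (m : ℕ) :
    ∫ ω, (∑ j ∈ Finset.range (m + 1), X j ω) ^ 2 ∂μ = (m + 1 : ℕ) := by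
  induction m with
  | zero => simpa using h1
  | succ m ih =>
    have := integral_sq_step hX hindep hident h0 h1 hL2 (N := m) (B := Set.univ)
      MeasurableSet.univ
    simp only [Measure.restrict_univ, probReal_univ] at this
    rw [this, ih]; push_cast; ring

lemma tail_bound {X : ℕ → Ω → ℝ} (hX : ∀ i, Measurable (X i)) (hindep : iIndepFun X μ)
    (hident : ∀ i, IdentDistrib (X i) (X 0) μ μ) (h0 : ∫ ω, X 0 ω ∂μ = 0)
    (h1 : ∫ ω, X 0 ω ^ 2 ∂μ = 1) (hL2 : ∀ i, MemLp (X i) 2 μ) {m : ℕ} (hm : 1 ≤ m)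
    {l : ℝ} (hl : 0 < l) :
    μ.real {ω | ∃ i, m ≤ i ∧ l * i < ∑ j ∈ Finset.range i, X j ω} ≤ 2 / (m * l ^ 2) := by
  set Z : ℕ → Ω → ℝ := fun k ω =>
    ((∑ j ∈ Finset.range k, X j ω) ^ 2 / k ^ 2 + 1 / k) / l ^ 2 with hZdef
  have hS : ∀ k, MemLp (fun ω => ∑ j ∈ Finset.range k, X j ω) 2 μ :=
    fun k => memLp_finsetSum _ fun j _ => hL2 j
  have hInt : ∀ k, Integrable (Z k) μ := fun k =>
    (((hS k).integrable_sq.div_const _).add (integrable_const _)).div_const _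
  have hZ0 : ∀ k ω, 0 ≤ Z k ω := fun k ω => by simp only [hZdef]; positivity
  have hZn : ∀ N k, k ≤ N + 1 →
      Measurable[Filtration.natural X (fun i => (hX i).stronglyMeasurable) N] (Z k) := by
    intro N k hk
    have := measurable_sum_natural hX hk measurable_id
    simp only [id] at this
    exact (((this.pow_const 2).div_const _).add_const _).div_const _
  have hZm : ∀ k, Measurable (Z k) := fun k =>
    (hZn k k (by omega)).mono (Filtration.le _ _) le_rfl
  have hstep : ∀ N, m ≤ N → ∫ ω in stayBelow Z m N, Z (N + 1) ω ∂μ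
      ≤ 1 * ∫ ω in stayBelow Z m N, Z N ω ∂μ := by
    intro N hN
    obtain ⟨N, rfl⟩ : ∃ N', N = N' + 1 := ⟨N - 1, by omega⟩
    have hB : MeasurableSet[Filtration.natural X (fun i => (hX i).stronglyMeasurable) N]
      (stayBelow Z m (N + 1)) := measurableSet_stayBelow fun k hk => hZn N k hk
    have hs := integral_sq_step hX hindep hident h0 h1 hL2 hB
    have ev : ∀ k, ∫ ω in stayBelow Z m (N + 1), Z k ω ∂μ
        = ((∫ ω in stayBelow Z m (N + 1), (∑ j ∈ Finset.range k, X j ω) ^ 2 ∂μ) / k ^ 2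
          + μ.real (stayBelow Z m (N + 1)) * (1 / k)) / l ^ 2 := by
      intro k
      simp only [hZdef]
      rw [integral_div, integral_add ((hS k).integrable_sq.div_const _).integrableOn
        (integrable_const _), integral_div]
      simp
    rw [ev, ev, hs, one_mul]
    have ha : 0 ≤ ∫ ω in stayBelow Z m (N + 1), (∑ j ∈ Finset.range (N + 1), X j ω) ^ 2 ∂μ :=
      integral_nonneg fun ω => sq_nonneg _
    have hb : 0 ≤ μ.real (stayBelow Z m (N + 1)) := measureReal_nonneg
    generalize (∫ ω in stayBelow Z m (N + 1), (∑ j ∈ Finset.range (N + 1), X j ω) ^ 2 ∂μ) = a at *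
    generalize μ.real (stayBelow Z m (N + 1)) = b at *
    refine div_le_div_of_nonneg_right ?_ (sq_nonneg l)
    push_cast
    have hN0 : (0 : ℝ) ≤ N := Nat.cast_nonneg N
    generalize (N : ℝ) = t at *
    have e1 : a / (t + 1 + 1) ^ 2 ≤ a / (t + 1) ^ 2 := by gcongr; linarith
    have e2 : 1 / (t + 1 + 1) ^ 2 + 1 / (t + 1 + 1) ≤ 1 / (t + 1) := by
      rw [div_add_div _ _ (by positivity) (by positivity), div_le_div_iff₀ (by positivity)
        (by positivity)]
      nlinarith [sq_nonneg t, mul_nonneg hN0 (sq_nonneg t)]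
    calc (a + b) / (t + 1 + 1) ^ 2 + b * (1 / (t + 1 + 1))
        = a / (t + 1 + 1) ^ 2 + b * (1 / (t + 1 + 1) ^ 2 + 1 / (t + 1 + 1)) := by ring
      _ ≤ _ := by gcongr
  have hmean : ∫ ω, min 1 (Z m ω) ∂μ ≤ 2 / (m * l ^ 2) := by
    calc ∫ ω, min 1 (Z m ω) ∂μ ≤ ∫ ω, Z m ω ∂μ :=
          integral_mono ((integrable_const _).inf (hInt _)) (hInt _) fun ω => min_le_right _ _
      _ = 2 / (m * l ^ 2) := by
        obtain ⟨m, rfl⟩ : ∃ m', m = m' + 1 := ⟨m - 1, by omega⟩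
        simp only [hZdef]
        rw [integral_div, integral_add ((hS _).integrable_sq.div_const _)
          (integrable_const _), integral_div,
          integral_sum_sq hX hindep hident h0 h1 hL2 m]
        have : ((m + 1 : ℕ) : ℝ) ≠ 0 := by positivity
        simp only [integral_const, probReal_univ, one_smul]
        field_simp
        norm_num
  have hfin : ∀ r, μ.real (stayBelow Z m (m + r))ᶜ ≤ 2 / (m * l ^ 2) := by
    intro r
    have := maximal_upper hZm hInt hZ0 le_rfl hstep r
    have h3 : 0 ≤ ∫ ω in stayBelow Z m (m + r), Z (m + r) ω ∂μ :=
      integral_nonneg fun ω => hZ0 _ _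
    rw [one_pow, one_mul] at this
    linarith
  have hsub : {ω | ∃ i, m ≤ i ∧ l * i < ∑ j ∈ Finset.range i, X j ω}
      ⊆ ⋃ r, (stayBelow Z m (m + r))ᶜ := by
    rintro ω ⟨i, hi, hlt⟩
    refine Set.mem_iUnion.2 ⟨i - m, fun hst => ?_⟩
    have := hst i hi (by omega)
    simp only [hZdef] at this
    have hi0 : (0 : ℝ) < i := by exact_mod_cast (by omega : 0 < i)
    rw [div_le_one (by positivity)] at this
    have h4 : (l * i) ^ 2 < (∑ j ∈ Finset.range i, X j ω) ^ 2 := by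
      gcongr
    have h5 : l ^ 2 < (∑ j ∈ Finset.range i, X j ω) ^ 2 / i ^ 2 := by
      rw [lt_div_iff₀ (by positivity)]; linarith [mul_pow l (i : ℝ) 2]
    have h6 : (0 : ℝ) ≤ 1 / i := by positivity
    linarith
  have hmono : Monotone fun r => (stayBelow Z m (m + r))ᶜ := by
    refine monotone_nat_of_le_succ fun r => ?_
    exact Set.compl_subset_compl.2 (stayBelow_succ_subset Z m (m + r))
  have hU : μ (⋃ r, (stayBelow Z m (m + r))ᶜ) ≤ ENNReal.ofReal (2 / (m * l ^ 2)) := by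
    rw [hmono.measure_iUnion]
    refine iSup_le fun r => ?_
    rw [← ofReal_measureReal]
    exact ENNReal.ofReal_le_ofReal (hfin r)
  exact ENNReal.toReal_le_of_le_ofReal (by positivity) ((measure_mono hsub).trans hU)

end TailPart


section TruncPart

/-- Truncation at level `c`. -/
noncomputable def trunc (c y : ℝ) : ℝ := if |y| ≤ c then y else 0

lemma measurable_trunc (c : ℝ) : Measurable (trunc c) :=
  Measurable.ite (measurableSet_le (by fun_prop) measurable_const) measurable_id measurable_const

lemma abs_trunc_le {c : ℝ} (hc : 0 ≤ c) (y : ℝ) : |trunc c y| ≤ c := by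
  unfold trunc
  split_ifs with h
  · exact h
  · simpa using hc

lemma abs_exp_sub_two (u : ℝ) : |Real.exp u - 1 - u| ≤ u ^ 2 * Real.exp |u| := by
  have := Complex.norm_exp_sub_sum_le_norm_mul_exp (u : ℂ) 2
  simp only [Finset.sum_range_succ, Finset.sum_range_zero, zero_add, pow_zero, pow_one,
    Nat.factorial, Nat.cast_one, div_one, Complex.norm_real, Real.norm_eq_abs, sq_abs] at this
  norm_num at this
  rw [← sub_sub] at this
  exact_mod_cast this

lemma abs_exp_sub_three (u : ℝ) : |Real.exp u - 1 - u - u ^ 2 / 2| ≤ |u| ^ 3 * Real.exp |u| := by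
  have := Complex.norm_exp_sub_sum_le_norm_mul_exp (u : ℂ) 3
  simp only [Finset.sum_range_succ, Finset.sum_range_zero, zero_add, pow_zero, pow_one,
    Nat.factorial, Nat.cast_one, div_one, Complex.norm_real, Real.norm_eq_abs] at this
  norm_num at this
  rw [← sub_sub, ← sub_sub] at this
  exact_mod_cast this

/-- One-step multiplicative increment of the truncated exponential process. -/
noncomputable def incr (x ε : ℝ) (n : ℕ) (y : ℝ) : ℝ :=
  2 * x * (√n)⁻¹ * trunc (ε * √n) y - 2 * x ^ 2 / n

lemma measurable_incr (x ε : ℝ) (n : ℕ) : Measurable (incr x ε n) :=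
  ((measurable_trunc _).const_mul _).sub_const _

lemma abs_lin_le {x ε : ℝ} (hx : 0 < x) (hε : 0 < ε) {n : ℕ} (hn : 1 ≤ n) (y : ℝ) :
    |2 * x * (√n)⁻¹ * trunc (ε * √n) y| ≤ 2 * x * ε := by
  have hs : 0 < √(n : ℝ) := Real.sqrt_pos.2 (by exact_mod_cast hn)
  rw [abs_mul, abs_of_pos (by positivity : 0 < 2 * x * (√(n : ℝ))⁻¹)]
  calc 2 * x * (√(n : ℝ))⁻¹ * |trunc (ε * √n) y| ≤ 2 * x * (√(n : ℝ))⁻¹ * (ε * √n) := by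
        gcongr; exact abs_trunc_le (by positivity) y
    _ = 2 * x * ε := by field_simp

lemma incr_le {x ε : ℝ} (hx : 0 < x) (hε : 0 < ε) {n : ℕ} (hn : 1 ≤ n) (y : ℝ) :
    incr x ε n y ≤ 2 * x * ε := by
  have := (abs_le.1 (abs_lin_le hx hε hn y)).2
  have h2 : 0 ≤ 2 * x ^ 2 / n := by positivity
  unfold incr; linarith

/-- Remainder of the second order expansion, in scaled form. -/
noncomputable def remn (x ε : ℝ) (n : ℕ) (y : ℝ) : ℝ :=
  n * (Real.exp (incr x ε n y) - 1 - 2 * x * (√n)⁻¹ * y - 2 * x ^ 2 / n * (y ^ 2 - 1))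

lemma abs_remn_le {x ε : ℝ} (hx : 0 < x) (hε : 0 < ε) {n : ℕ} (hn : 1 ≤ n) (y : ℝ) :
    |remn x ε n y| ≤ ((8 * x ^ 2 + 8 * x ^ 4) * Real.exp (2 * x * ε + 2 * x ^ 2) + 8 * x ^ 2
      + 2 * x / ε) * (1 + y ^ 2) := by
  have hn0 : (1 : ℝ) ≤ n := by exact_mod_cast hn
  have hs : 0 < √(n : ℝ) := Real.sqrt_pos.2 (by linarith)
  have hsq : √(n : ℝ) ^ 2 = n := Real.sq_sqrt (by linarith)
  have hE : 1 ≤ Real.exp (2 * x * ε + 2 * x ^ 2) := Real.one_le_exp (by positivity)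
  unfold remn
  by_cases h : |y| ≤ ε * √n
  · have hlin := abs_lin_le hx hε hn y
    have ht : trunc (ε * √n) y = y := if_pos h
    rw [ht] at hlin
    set u := incr x ε n y with hu
    have hu' : u = 2 * x * (√n)⁻¹ * y - 2 * x ^ 2 / n := by rw [hu, incr, ht]
    have hd : 2 * x ^ 2 / n ≤ 2 * x ^ 2 := div_le_self (by positivity) hn0
    have hd0 : 0 ≤ 2 * x ^ 2 / n := by positivity
    have hua : |u| ≤ 2 * x * ε + 2 * x ^ 2 := by
      rw [hu']
      calc _ ≤ |2 * x * (√n)⁻¹ * y| + |2 * x ^ 2 / n| := abs_sub _ _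
        _ ≤ _ := by rw [abs_of_nonneg hd0]; linarith
    have e1 : n * (Real.exp u - 1 - 2 * x * (√n)⁻¹ * y - 2 * x ^ 2 / n * (y ^ 2 - 1))
        = n * (Real.exp u - 1 - u) - 2 * x ^ 2 * y ^ 2 := by
      rw [hu']; field_simp; ring
    have e2 : n * u ^ 2 ≤ 8 * x ^ 2 * y ^ 2 + 8 * x ^ 4 := by
      have h3 : u ^ 2 ≤ 2 * (2 * x * (√n)⁻¹ * y) ^ 2 + 2 * (2 * x ^ 2 / n) ^ 2 := by
        rw [hu']; nlinarith [sq_nonneg (2 * x * (√n)⁻¹ * y + 2 * x ^ 2 / n)]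
      have h4 : n * (2 * (2 * x * (√n)⁻¹ * y) ^ 2 + 2 * (2 * x ^ 2 / n) ^ 2)
          = 8 * x ^ 2 * y ^ 2 + 8 * x ^ 4 / n := by
        simp only [mul_pow, inv_pow, hsq]
        field_simp
        ring
      have h5 : 8 * x ^ 4 / n ≤ 8 * x ^ 4 := div_le_self (by positivity) hn0
      calc n * u ^ 2 ≤ _ := mul_le_mul_of_nonneg_left h3 (by linarith)
        _ ≤ _ := by rw [h4]; linarith
    have e3 : |n * (Real.exp u - 1 - u)|
        ≤ (8 * x ^ 2 * y ^ 2 + 8 * x ^ 4) * Real.exp (2 * x * ε + 2 * x ^ 2) := by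
      rw [abs_mul, abs_of_nonneg (by linarith : (0 : ℝ) ≤ n)]
      calc n * |Real.exp u - 1 - u| ≤ n * (u ^ 2 * Real.exp |u|) := by
            gcongr; exact abs_exp_sub_two u
        _ = n * u ^ 2 * Real.exp |u| := by ring
        _ ≤ _ := by gcongr
    rw [e1]
    calc _ ≤ |n * (Real.exp u - 1 - u)| + |2 * x ^ 2 * y ^ 2| := abs_sub _ _
      _ ≤ (8 * x ^ 2 * y ^ 2 + 8 * x ^ 4) * Real.exp (2 * x * ε + 2 * x ^ 2)
          + 2 * x ^ 2 * y ^ 2 := by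
        rw [abs_of_nonneg (by positivity : 0 ≤ 2 * x ^ 2 * y ^ 2)]; linarith
      _ ≤ ((8 * x ^ 2 + 8 * x ^ 4) * (1 + y ^ 2)) * Real.exp (2 * x * ε + 2 * x ^ 2)
          + 8 * x ^ 2 * (1 + y ^ 2) + 2 * x / ε * (1 + y ^ 2) := by
        have p1 : 0 ≤ 2 * x / ε * (1 + y ^ 2) := by positivity
        have p2 : 8 * x ^ 2 * y ^ 2 + 8 * x ^ 4 ≤ (8 * x ^ 2 + 8 * x ^ 4) * (1 + y ^ 2) := by
          have : 0 ≤ x ^ 4 * y ^ 2 := by positivity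
          nlinarith [sq_nonneg x]
        have p3 := mul_le_mul_of_nonneg_right p2 (zero_le_one.trans hE)
        have p4 : 0 ≤ x ^ 2 * y ^ 2 := by positivity
        nlinarith [sq_nonneg x]
      _ = _ := by ring
  · have ht : trunc (ε * √n) y = 0 := if_neg h
    have hu : incr x ε n y = -(2 * x ^ 2 / n) := by rw [incr, ht]; ring
    have h' : ε * √n < |y| := lt_of_not_ge h
    rw [hu]
    have hd0 : 0 ≤ 2 * x ^ 2 / n := by positivity
    have e1 : |n * (Real.exp (-(2 * x ^ 2 / n)) - 1)| ≤ 2 * x ^ 2 := by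
      have a1 : Real.exp (-(2 * x ^ 2 / n)) ≤ 1 := Real.exp_le_one_iff.2 (by linarith)
      have a2 := Real.add_one_le_exp (-(2 * x ^ 2 / n))
      rw [abs_mul, abs_of_nonneg (by linarith : (0 : ℝ) ≤ n), abs_of_nonpos (by linarith)]
      calc n * -(Real.exp (-(2 * x ^ 2 / n)) - 1) ≤ n * (2 * x ^ 2 / n) := by
            gcongr; linarith
        _ = 2 * x ^ 2 := by field_simp
    have e2 : |n * (2 * x * (√n)⁻¹ * y)| ≤ 2 * x / ε * y ^ 2 := by
      have : n * (2 * x * (√n)⁻¹ * y) = 2 * x * √n * y := by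
        nth_rewrite 1 [← hsq]; field_simp
      rw [this, abs_mul, abs_of_pos (by positivity)]
      have : √(n : ℝ) ≤ |y| / ε := by rw [le_div_iff₀ hε]; linarith
      calc 2 * x * √n * |y| ≤ 2 * x * (|y| / ε) * |y| := by gcongr
        _ = 2 * x / ε * |y| ^ 2 := by ring
        _ = _ := by rw [sq_abs]
    have e3 : |n * (2 * x ^ 2 / n * (y ^ 2 - 1))| ≤ 2 * x ^ 2 * (1 + y ^ 2) := by
      have : n * (2 * x ^ 2 / n * (y ^ 2 - 1)) = 2 * x ^ 2 * (y ^ 2 - 1) := by field_simp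
      rw [this, abs_mul, abs_of_nonneg (by positivity)]
      gcongr
      rw [abs_le]; constructor <;> nlinarith [sq_nonneg y]
    have e4 : n * (Real.exp (-(2 * x ^ 2 / n)) - 1 - 2 * x * (√n)⁻¹ * y
        - 2 * x ^ 2 / n * (y ^ 2 - 1)) = n * (Real.exp (-(2 * x ^ 2 / n)) - 1)
        - n * (2 * x * (√n)⁻¹ * y) - n * (2 * x ^ 2 / n * (y ^ 2 - 1)) := by ring
    rw [e4]
    calc _ ≤ |n * (Real.exp (-(2 * x ^ 2 / n)) - 1)| + |n * (2 * x * (√n)⁻¹ * y)|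
          + |n * (2 * x ^ 2 / n * (y ^ 2 - 1))| :=
          (abs_sub _ _).trans (add_le_add_left (abs_sub _ _) _)
      _ ≤ 2 * x ^ 2 + 2 * x / ε * y ^ 2 + 2 * x ^ 2 * (1 + y ^ 2) := by gcongr
      _ ≤ ((8 * x ^ 2 + 8 * x ^ 4) * (1 + y ^ 2)) * Real.exp (2 * x * ε + 2 * x ^ 2)
          + 8 * x ^ 2 * (1 + y ^ 2) + 2 * x / ε * (1 + y ^ 2) := by
        have p1 : 0 ≤ 2 * x / ε := by positivity
        have p2 : 0 ≤ ((8 * x ^ 2 + 8 * x ^ 4) * (1 + y ^ 2)) *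
          Real.exp (2 * x * ε + 2 * x ^ 2) := by positivity
        have p4 : 0 ≤ x ^ 2 * y ^ 2 := by positivity
        nlinarith [sq_nonneg x]
      _ = _ := by ring

lemma tendsto_inv_sqrt_nat : Tendsto (fun n : ℕ => (√(n : ℝ))⁻¹) atTop (nhds 0) :=
  tendsto_inv_atTop_zero.comp (Real.tendsto_sqrt_atTop.comp tendsto_natCast_atTop_atTop)

lemma eventually_le_mul_sqrt {ε : ℝ} (hε : 0 < ε) (y : ℝ) : ∀ᶠ n : ℕ in atTop, y ≤ ε * √n :=
  ((Real.tendsto_sqrt_atTop.comp tendsto_natCast_atTop_atTop).const_mul_atTop hε).eventually_ge_atTop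
    y

lemma tendsto_remn {x ε : ℝ} (hε : 0 < ε) (y : ℝ) :
    Tendsto (fun n : ℕ => remn x ε n y) atTop (nhds 0) := by
  let b : ℝ → ℝ := fun s => s * |2 * x * y - 2 * x ^ 2 * s| ^ 3
      * Real.exp |s * (2 * x * y - 2 * x ^ 2 * s)|
    + |s * (-(4 * x ^ 3 * y) + 2 * x ^ 4 * s)|
  have hb : Tendsto (fun n : ℕ => b (√(n : ℝ))⁻¹) atTop (nhds 0) := by
    have hc : Continuous b := by fun_prop
    have h0 : b 0 = 0 := by simp [b]
    rw [← h0]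
    exact (hc.tendsto 0).comp tendsto_inv_sqrt_nat
  apply squeeze_zero_norm' _ hb
  filter_upwards [eventually_le_mul_sqrt hε |y|, eventually_ge_atTop 1] with n hy hn
  have hn0 : (1 : ℝ) ≤ n := by exact_mod_cast hn
  have hs : 0 < √(n : ℝ) := Real.sqrt_pos.2 (by linarith)
  have hsq : √(n : ℝ) ^ 2 = n := Real.sq_sqrt (by linarith)
  have ht : trunc (ε * √n) y = y := if_pos hy
  set s := (√(n : ℝ))⁻¹ with hsdef
  have hs0 : 0 < s := inv_pos.2 hs
  have hns : (n : ℝ) = (s ^ 2)⁻¹ := by rw [hsdef, inv_pow, inv_inv, hsq]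
  have hu : incr x ε n y = s * (2 * x * y - 2 * x ^ 2 * s) := by
    rw [incr, ht, ← hsdef, hns]; field_simp
  unfold remn
  rw [hu, ← hsdef, hns]
  set u := s * (2 * x * y - 2 * x ^ 2 * s) with hudef
  have e1 : (s ^ 2)⁻¹ * (Real.exp u - 1 - 2 * x * s * y - 2 * x ^ 2 / (s ^ 2)⁻¹ * (y ^ 2 - 1))
      = (s ^ 2)⁻¹ * (Real.exp u - 1 - u - u ^ 2 / 2)
        + s * (-(4 * x ^ 3 * y) + 2 * x ^ 4 * s) := by
    generalize Real.exp u = E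
    rw [hudef]; field_simp; ring
  rw [e1, Real.norm_eq_abs]
  refine (abs_add_le _ _).trans (add_le_add_left ?_ _)
  rw [abs_mul, abs_of_pos (by positivity : 0 < (s ^ 2)⁻¹)]
  calc (s ^ 2)⁻¹ * |Real.exp u - 1 - u - u ^ 2 / 2| ≤ (s ^ 2)⁻¹ * (|u| ^ 3 * Real.exp |u|) := by
        gcongr; exact abs_exp_sub_three u
    _ = _ := by
      have : |u| ^ 3 = s ^ 3 * |2 * x * y - 2 * x ^ 2 * s| ^ 3 := by
        rw [hudef, abs_mul, abs_of_pos hs0, mul_pow]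
      rw [this, ← hudef]
      generalize |2 * x * y - 2 * x ^ 2 * s| = w
      generalize Real.exp |u| = E
      field_simp

variable {Ω : Type*} [MeasurableSpace Ω] {μ : Measure Ω} [IsProbabilityMeasure μ]

lemma integrable_exp_incr {x ε : ℝ} (hx : 0 < x) (hε : 0 < ε) {n : ℕ} (hn : 1 ≤ n) {Y : Ω → ℝ}
    (hY : Measurable Y) : Integrable (fun ω => Real.exp (incr x ε n (Y ω))) μ := by
  refine Integrable.of_bound (C := Real.exp (2 * x * ε))
    (Real.measurable_exp.comp ((measurable_incr x ε n).comp hY)).aestronglyMeasurable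
    (ae_of_all _ fun ω => ?_)
  rw [Real.norm_eq_abs, abs_of_pos (Real.exp_pos _)]
  exact Real.exp_le_exp.2 (incr_le hx hε hn _)

lemma tendsto_rho {Y : Ω → ℝ} (hY : Measurable Y) (h0 : ∫ ω, Y ω ∂μ = 0)
    (h1 : ∫ ω, Y ω ^ 2 ∂μ = 1) (hL2 : MemLp Y 2 μ) {x ε : ℝ} (hx : 0 < x) (hε : 0 < ε) :
    Tendsto (fun n : ℕ => n * |∫ ω, Real.exp (incr x ε n (Y ω)) ∂μ - 1|) atTop (nhds 0) := by
  have iY : Integrable Y μ := hL2.integrable one_le_two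
  have iY2 : Integrable (fun ω => Y ω ^ 2) μ := hL2.integrable_sq
  have key : Tendsto (fun n : ℕ => ∫ ω, remn x ε n (Y ω) ∂μ) atTop (nhds (∫ _, (0 : ℝ) ∂μ)) := by
    refine tendsto_integral_filter_of_dominated_convergence
      (fun ω => ((8 * x ^ 2 + 8 * x ^ 4) * Real.exp (2 * x * ε + 2 * x ^ 2) + 8 * x ^ 2
      + 2 * x / ε) * (1 + Y ω ^ 2)) ?_ ?_ (((integrable_const _).add iY2).const_mul _)
      (ae_of_all _ fun ω => tendsto_remn hε _)
    · refine Eventually.of_forall fun n => Measurable.aestronglyMeasurable ?_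
      have := measurable_incr x ε n
      unfold remn
      fun_prop
    · filter_upwards [eventually_ge_atTop 1] with n hn
      exact ae_of_all _ fun ω => abs_remn_le hx hε hn _
  rw [integral_zero] at key
  have key2 := key.abs
  rw [abs_zero] at key2
  refine key2.congr' ?_
  filter_upwards [eventually_ge_atTop 1] with n hn
  have i1 := integrable_exp_incr (μ := μ) hx hε hn hY
  have i2 : Integrable (fun ω => Real.exp (incr x ε n (Y ω)) - 1) μ := i1.sub (integrable_const _)
  have i3 : Integrable (fun ω => Real.exp (incr x ε n (Y ω)) - 1 - 2 * x * (√n)⁻¹ * Y ω) μ :=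
    i2.sub (iY.const_mul _)
  have i4 : Integrable (fun ω => 2 * x ^ 2 / n * (Y ω ^ 2 - 1)) μ :=
    (iY2.sub (integrable_const _)).const_mul _
  unfold remn
  rw [integral_const_mul, integral_sub i3 i4, integral_sub i2 (iY.const_mul _),
    integral_sub i1 (integrable_const _), integral_const_mul, integral_const_mul,
    integral_sub iY2 (integrable_const _), h0, h1, abs_mul]
  simp

lemma tendsto_trunc_prob {Y : Ω → ℝ} (hY : Measurable Y) (hL2 : MemLp Y 2 μ) {ε : ℝ}
    (hε : 0 < ε) :
    Tendsto (fun n : ℕ => n * μ.real {ω | ε * √n < |Y ω|}) atTop (nhds 0) := by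
  have hm : ∀ n : ℕ, MeasurableSet {ω | ε * √n < |Y ω|} := fun n =>
    measurableSet_lt measurable_const (by fun_prop)
  have iY2 : Integrable (fun ω => Y ω ^ 2) μ := hL2.integrable_sq
  have key : Tendsto (fun n : ℕ => ∫ ω, {ω | ε * √n < |Y ω|}.indicator (fun _ => (n : ℝ)) ω ∂μ)
      atTop (nhds (∫ _, (0 : ℝ) ∂μ)) := by
    refine tendsto_integral_filter_of_dominated_convergence
      (fun ω => 1 / ε ^ 2 * Y ω ^ 2) ?_ ?_ (iY2.const_mul _) (ae_of_all _ fun ω => ?_)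
    · exact Eventually.of_forall fun n =>
        (measurable_const.indicator (hm n)).aestronglyMeasurable
    · refine Eventually.of_forall fun n => ae_of_all _ fun ω => ?_
      by_cases h : ω ∈ {ω | ε * √n < |Y ω|}
      · have h' : ε * √n < |Y ω| := h
        rw [Set.indicator_of_mem h, Real.norm_eq_abs, abs_of_nonneg (Nat.cast_nonneg n)]
        have : (ε * √n) ^ 2 ≤ |Y ω| ^ 2 := by gcongr
        rw [mul_pow, Real.sq_sqrt (Nat.cast_nonneg n), sq_abs] at this
        rw [one_div, ← div_eq_inv_mul, le_div_iff₀ (by positivity)]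
        linarith
      · rw [Set.indicator_of_notMem h, norm_zero]; positivity
    · refine tendsto_const_nhds.congr' ?_
      filter_upwards [eventually_le_mul_sqrt hε |Y ω|] with n hn
      rw [Set.indicator_of_notMem]
      exact not_lt.2 hn
  rw [integral_zero] at key
  refine key.congr fun n => ?_
  rw [integral_indicator (hm n)]
  simp [mul_comm]

end TruncPart


section FinalPart
variable {Ω : Type*} [MeasurableSpace Ω] {μ : Measure Ω} [IsProbabilityMeasure μ]

/-- The truncated exponential process. -/
noncomputable def expProc (X : ℕ → Ω → ℝ) (x ε : ℝ) (n k : ℕ) (ω : Ω) : ℝ :=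
  Real.exp (∑ j ∈ Finset.range k, incr x ε n (X j ω))

lemma expProc_succ (X : ℕ → Ω → ℝ) (x ε : ℝ) (n k : ℕ) (ω : Ω) :
    expProc X x ε n (k + 1) ω = expProc X x ε n k ω * Real.exp (incr x ε n (X k ω)) := by
  rw [expProc, expProc, Finset.sum_range_succ, Real.exp_add]

lemma measurable_expProc_natural {X : ℕ → Ω → ℝ} (hX : ∀ i, Measurable (X i)) (x ε : ℝ) (n : ℕ)
    {k N : ℕ} (h : k ≤ N + 1) :
    Measurable[Filtration.natural X (fun i => (hX i).stronglyMeasurable) N]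
      (expProc X x ε n k) :=
  Real.measurable_exp.comp (measurable_sum_natural hX h (measurable_incr x ε n))

lemma measurable_expProc {X : ℕ → Ω → ℝ} (hX : ∀ i, Measurable (X i)) (x ε : ℝ) (n k : ℕ) :
    Measurable (expProc X x ε n k) :=
  (measurable_expProc_natural hX x ε n (k.le_succ)).mono (Filtration.le _ _) le_rfl

lemma integrable_expProc {X : ℕ → Ω → ℝ} (hX : ∀ i, Measurable (X i)) {x ε : ℝ} (hx : 0 < x)
    (hε : 0 < ε) {n : ℕ} (hn : 1 ≤ n) (k : ℕ) : Integrable (expProc X x ε n k) μ := by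
  refine Integrable.of_bound (C := Real.exp (k * (2 * x * ε)))
    (measurable_expProc hX x ε n k).aestronglyMeasurable (ae_of_all _ fun ω => ?_)
  rw [Real.norm_eq_abs, expProc, abs_of_pos (Real.exp_pos _)]
  apply Real.exp_le_exp.2
  calc _ ≤ ∑ j ∈ Finset.range k, 2 * x * ε := Finset.sum_le_sum fun j _ => incr_le hx hε hn _
    _ = _ := by simp

lemma expProc_step {X : ℕ → Ω → ℝ} (hX : ∀ i, Measurable (X i)) (hindep : iIndepFun X μ)
    (hident : ∀ i, IdentDistrib (X i) (X 0) μ μ) (x ε : ℝ) {n N : ℕ} (hn : 1 ≤ n) (hN : n ≤ N) :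
    ∫ ω in stayBelow (expProc X x ε n) n N, expProc X x ε n (N + 1) ω ∂μ
      = (∫ ω, Real.exp (incr x ε n (X 0 ω)) ∂μ)
        * ∫ ω in stayBelow (expProc X x ε n) n N, expProc X x ε n N ω ∂μ := by
  obtain ⟨N, rfl⟩ : ∃ N', N = N' + 1 := ⟨N - 1, by omega⟩
  have hB : MeasurableSet[Filtration.natural X (fun i => (hX i).stronglyMeasurable) N]
      (stayBelow (expProc X x ε n) n (N + 1)) :=
    measurableSet_stayBelow fun k hk => measurable_expProc_natural hX x ε n hk
  have hBm : MeasurableSet (stayBelow (expProc X x ε n) n (N + 1)) := Filtration.le _ _ _ hB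
  have := integral_past_mul hX hindep hident
    ((measurable_expProc_natural hX x ε n (le_refl (N + 1))).indicator hB)
    (Real.measurable_exp.comp (measurable_incr x ε n))
  simp only [Function.comp] at this
  rw [← integral_indicator hBm, ← integral_indicator hBm, mul_comm, ← this]
  congr 1
  ext ω
  by_cases hω : ω ∈ stayBelow (expProc X x ε n) n (N + 1) <;> simp [hω, expProc_succ]

lemma integral_le_add_of_eq_on {f g : Ω → ℝ} {G : Set Ω} (hG : MeasurableSet G)
    (hf : Integrable f μ) (hg : Integrable g μ) (hf1 : ∀ ω, f ω ≤ 1) (hg0 : ∀ ω, 0 ≤ g ω)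
    (h : ∀ ω ∈ G, f ω = g ω) : ∫ ω, f ω ∂μ ≤ ∫ ω, g ω ∂μ + μ.real Gᶜ := by
  have hi : Integrable (Gᶜ.indicator (1 : Ω → ℝ)) μ :=
    (integrable_const (1 : ℝ)).indicator hG.compl
  rw [← integral_indicator_one hG.compl, ← integral_add hg hi]
  refine integral_mono hf (hg.add hi) fun ω => ?_
  by_cases hω : ω ∈ G
  · simp [hω, h ω hω]
  · simp only [Pi.add_apply, Set.indicator_of_mem (Set.mem_compl hω), Pi.one_apply]
    linarith [hf1 ω, hg0 ω]

/-- The event that no variable is truncated before time `N`. -/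
def goodSet (X : ℕ → Ω → ℝ) (c : ℝ) (N : ℕ) : Set Ω := {ω | ∀ j, j < N → |X j ω| ≤ c}

lemma goodSet_compl (X : ℕ → Ω → ℝ) (c : ℝ) (N : ℕ) :
    (goodSet X c N)ᶜ = ⋃ j ∈ Finset.range N, {ω | c < |X j ω|} := by
  ext ω; simp [goodSet]

lemma measurableSet_goodSet {X : ℕ → Ω → ℝ} (hX : ∀ i, Measurable (X i)) (c : ℝ) (N : ℕ) :
    MeasurableSet (goodSet X c N) := by
  rw [← MeasurableSet.compl_iff, goodSet_compl]
  exact Finset.measurableSet_biUnion _ fun j _ =>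
    measurableSet_lt measurable_const ((hX j).abs)

lemma goodSet_compl_le {X : ℕ → Ω → ℝ}
    (hident : ∀ i, IdentDistrib (X i) (X 0) μ μ) (c : ℝ) (N : ℕ) :
    μ.real (goodSet X c N)ᶜ ≤ N * μ.real {ω | c < |X 0 ω|} := by
  rw [goodSet_compl]
  refine (measureReal_biUnion_finset_le _ _).trans ?_
  have : ∀ j ∈ Finset.range N, μ.real {ω | c < |X j ω|} = μ.real {ω | c < |X 0 ω|} := by
    intro j _
    have hs : MeasurableSet {y : ℝ | c < |y|} := measurableSet_lt measurable_const measurable_id.abs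
    have := (hident j).measure_mem_eq hs
    rw [measureReal_def, measureReal_def]
    exact congrArg ENNReal.toReal this
  rw [Finset.sum_congr rfl this]
  simp

lemma expProc_eq_of_good {X : ℕ → Ω → ℝ} {x ε : ℝ} {n N k : ℕ} (hk : k ≤ N) {ω : Ω}
    (h : ω ∈ goodSet X (ε * √n) N) :
    expProc X x ε n k ω
      = Real.exp (2 * x * (√n)⁻¹ * (∑ j ∈ Finset.range k, X j ω) - 2 * x ^ 2 * k / n) := by
  rw [expProc]
  congr 1
  have : ∀ j ∈ Finset.range k, incr x ε n (X j ω) = 2 * x * (√n)⁻¹ * X j ω - 2 * x ^ 2 / n := by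
    intro j hj
    have hj' := Finset.mem_range.1 hj
    rw [incr, trunc, if_pos (h j (by omega))]
  rw [Finset.sum_congr rfl this, Finset.sum_sub_distrib, ← Finset.mul_sum]
  simp
  ring

/-- The crossing event on the window `[n, N]`. -/
def crossSet (X : ℕ → Ω → ℝ) (x : ℝ) (n N : ℕ) : Set Ω :=
  {ω | ∃ k, n ≤ k ∧ k ≤ N ∧ x / √n * k < ∑ j ∈ Finset.range k, X j ω}

lemma cross_iff {X : ℕ → Ω → ℝ} {x ε : ℝ} (hx : 0 < x) {n N : ℕ} (hn : 1 ≤ n) {ω : Ω}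
    (h : ω ∈ goodSet X (ε * √n) N) :
    ω ∈ crossSet X x n N ↔ ω ∈ (stayBelow (expProc X x ε n) n N)ᶜ := by
  have hn0 : (1 : ℝ) ≤ n := by exact_mod_cast hn
  have hs : 0 < √(n : ℝ) := Real.sqrt_pos.2 (by linarith)
  have hsq : √(n : ℝ) ^ 2 = n := Real.sq_sqrt (by linarith)
  simp only [crossSet, stayBelow, Set.mem_compl_iff, Set.mem_ofPred_eq, not_forall, not_le,
    exists_prop]
  refine exists_congr fun k => and_congr_right fun _ => and_congr_right fun hk => ?_
  rw [expProc_eq_of_good hk h, Real.one_lt_exp_iff]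
  have : 2 * x * (√n)⁻¹ * (∑ j ∈ Finset.range k, X j ω) - 2 * x ^ 2 * k / n
      = 2 * x * (√n)⁻¹ * ((∑ j ∈ Finset.range k, X j ω) - x / √n * k) := by
    nth_rewrite 2 [← hsq]; field_simp
  rw [this, mul_pos_iff_of_pos_left (by positivity), sub_pos]

lemma measureReal_le_add_of_iff {A B G : Set Ω} (h : ∀ ω ∈ G, ω ∈ A → ω ∈ B) :
    μ.real A ≤ μ.real B + μ.real Gᶜ := by
  refine (measureReal_mono ?_).trans (measureReal_union_le _ _)
  intro ω hω
  by_cases hG : ω ∈ G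
  · exact Or.inl (h ω hG hω)
  · exact Or.inr hG

/-- The smooth functional of the sum. -/
noncomputable def cltInt (μ : Measure Ω) (X : ℕ → Ω → ℝ) (x : ℝ) (n : ℕ) : ℝ :=
  ∫ ω, min 1 (Real.exp (2 * x * ((√n)⁻¹ * ∑ k ∈ Finset.range n, X k ω) - 2 * x ^ 2)) ∂μ

lemma integrable_min_one {f : Ω → ℝ} (hf : Measurable f) :
    Integrable (fun ω => min 1 (Real.exp (f ω))) μ :=
  Integrable.of_bound (C := 1) (measurable_const.min (Real.measurable_exp.comp hf)).aestronglyMeasurable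
    (ae_of_all _ fun _ => min_one_exp_mem _)

lemma min_one_exp_nonneg (z : ℝ) : 0 ≤ min 1 (Real.exp z) := le_min zero_le_one (Real.exp_pos _).le

lemma measurable_arg {X : ℕ → Ω → ℝ} (hX : ∀ i, Measurable (X i)) (x : ℝ) (n : ℕ) :
    Measurable fun ω => 2 * x * ((√n)⁻¹ * ∑ k ∈ Finset.range n, X k ω) - 2 * x ^ 2 := by
  fun_prop

lemma measurable_sum_incr {X : ℕ → Ω → ℝ} (hX : ∀ i, Measurable (X i)) (x ε : ℝ) (n k : ℕ) :
    Measurable fun ω => ∑ j ∈ Finset.range k, incr x ε n (X j ω) :=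
  Finset.measurable_fun_sum _ fun j _ => (measurable_incr x ε n).comp (hX j)

/-- At time `T * n` the truncated process agrees with the CLT functional on the good event. -/
lemma expProc_eq_clt {X : ℕ → Ω → ℝ} {x ε : ℝ} {n N T : ℕ} (hn : 1 ≤ n) (hT : 1 ≤ T)
    (hN : T * n ≤ N) {ω : Ω} (h : ω ∈ goodSet X (ε * √n) N) :
    expProc X x ε n (T * n) ω = Real.exp (2 * (x * √T) *
      ((√((T * n : ℕ) : ℝ))⁻¹ * ∑ k ∈ Finset.range (T * n), X k ω) - 2 * (x * √T) ^ 2) := by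
  have hn0 : (1 : ℝ) ≤ n := by exact_mod_cast hn
  have hT0 : (1 : ℝ) ≤ T := by exact_mod_cast hT
  have hs : 0 < √(n : ℝ) := Real.sqrt_pos.2 (by linarith)
  have ht : 0 < √(T : ℝ) := Real.sqrt_pos.2 (by linarith)
  rw [expProc_eq_of_good hN h]
  congr 1
  push_cast
  rw [Real.sqrt_mul (by linarith), mul_pow, Real.sq_sqrt (by linarith : (0 : ℝ) ≤ T)]
  field_simp

lemma min_expProc_le {X : ℕ → Ω → ℝ} (hX : ∀ i, Measurable (X i)) {x ε : ℝ} {n N T : ℕ}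
    (hn : 1 ≤ n) (hT : 1 ≤ T) (hN : T * n ≤ N) :
    ∫ ω, min 1 (expProc X x ε n (T * n) ω) ∂μ
      ≤ cltInt μ X (x * √T) (T * n) + μ.real (goodSet X (ε * √n) N)ᶜ :=
  integral_le_add_of_eq_on (measurableSet_goodSet hX _ _)
    (integrable_min_one (measurable_sum_incr hX x ε n _))
    (integrable_min_one (measurable_arg hX _ _)) (fun _ => min_le_left _ _)
    (fun _ => min_one_exp_nonneg _) fun ω hω => by rw [expProc_eq_clt hn hT hN hω]

lemma le_min_expProc {X : ℕ → Ω → ℝ} (hX : ∀ i, Measurable (X i)) {x ε : ℝ} {n N T : ℕ}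
    (hn : 1 ≤ n) (hT : 1 ≤ T) (hN : T * n ≤ N) :
    cltInt μ X (x * √T) (T * n)
      ≤ ∫ ω, min 1 (expProc X x ε n (T * n) ω) ∂μ + μ.real (goodSet X (ε * √n) N)ᶜ :=
  integral_le_add_of_eq_on (measurableSet_goodSet hX _ _)
    (integrable_min_one (measurable_arg hX _ _))
    (integrable_min_one (measurable_sum_incr hX x ε n _)) (fun _ => min_le_left _ _)
    (fun _ => min_one_exp_nonneg _) fun ω hω => by rw [expProc_eq_clt hn hT hN hω]

lemma cross_upper {X : ℕ → Ω → ℝ} (hX : ∀ i, Measurable (X i)) (hindep : iIndepFun X μ)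
    (hident : ∀ i, IdentDistrib (X i) (X 0) μ μ) {x ε : ℝ} (hx : 0 < x) (hε : 0 < ε) {n T : ℕ}
    (hn : 1 ≤ n) (hT : 1 ≤ T) {e g : ℝ} (he : e = |∫ ω, Real.exp (incr x ε n (X 0 ω)) ∂μ - 1|)
    (hg : g = μ.real (goodSet X (ε * √n) (T * n))ᶜ) :
    μ.real (crossSet X x n (T * n)) ≤ Real.exp (T * (n * e)) * (cltInt μ X x n + g) + g := by
  have hnT : n ≤ T * n := Nat.le_mul_of_pos_left n hT
  have he0 : 0 ≤ e := he ▸ abs_nonneg _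
  have h1 : μ.real (crossSet X x n (T * n))
      ≤ μ.real (stayBelow (expProc X x ε n) n (T * n))ᶜ + g :=
    hg ▸ measureReal_le_add_of_iff fun ω hω h => (cross_iff hx hn hω).1 h
  have h2 := maximal_upper (measurable_expProc hX x ε n) (integrable_expProc (μ := μ) hX hx hε hn)
    (fun k ω => (Real.exp_pos _).le) (q := 1 + e) (n := n) (by linarith)
    (fun N hN => by
      rw [expProc_step hX hindep hident x ε hn hN]
      refine mul_le_mul_of_nonneg_right ?_ (integral_nonneg fun ω => (Real.exp_pos _).le)
      have := le_abs_self (∫ ω, Real.exp (incr x ε n (X 0 ω)) ∂μ - 1)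
      linarith) (T * n - n)
  rw [Nat.add_sub_cancel' hnT] at h2
  have h3 : 0 ≤ ∫ ω in stayBelow (expProc X x ε n) n (T * n), expProc X x ε n (T * n) ω ∂μ :=
    integral_nonneg fun ω => (Real.exp_pos _).le
  have h4 := min_expProc_le (μ := μ) hX (x := x) (ε := ε) hn le_rfl
    (by simpa using hnT : 1 * n ≤ T * n)
  simp only [Nat.cast_one, Real.sqrt_one, mul_one, one_mul] at h4
  rw [← hg] at h4
  have h5 : (1 + e) ^ (T * n - n) ≤ Real.exp (T * (n * e)) := by
    calc (1 + e) ^ (T * n - n) ≤ (1 + e) ^ (T * n) :=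
          pow_le_pow_right₀ (by linarith) (Nat.sub_le _ _)
      _ ≤ (Real.exp e) ^ (T * n) := by
        gcongr; linarith [Real.add_one_le_exp e]
      _ = _ := by rw [← Real.exp_nat_mul]; push_cast; ring_nf
  have h6 : 0 ≤ ∫ ω, min 1 (expProc X x ε n n ω) ∂μ :=
    integral_nonneg fun ω => min_one_exp_nonneg _
  have h7 : (1 + e) ^ (T * n - n) * ∫ ω, min 1 (expProc X x ε n n ω) ∂μ
      ≤ Real.exp (T * (n * e)) * (cltInt μ X x n + g) :=
    mul_le_mul h5 h4 h6 (Real.exp_pos _).le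
  linarith

lemma cross_lower {X : ℕ → Ω → ℝ} (hX : ∀ i, Measurable (X i)) (hindep : iIndepFun X μ)
    (hident : ∀ i, IdentDistrib (X i) (X 0) μ μ) {x ε : ℝ} (hx : 0 < x) (hε : 0 < ε) {n T : ℕ}
    (hn : 1 ≤ n) (hT : 1 ≤ T) {e g : ℝ} (he : e = |∫ ω, Real.exp (incr x ε n (X 0 ω)) ∂μ - 1|)
    (hg : g = μ.real (goodSet X (ε * √n) (T * n))ᶜ) (he1 : T * (n * e) ≤ 1) :
    (1 - T * (n * e)) * (cltInt μ X x n - g) ≤ cltInt μ X (x * √T) (T * n) + g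
      + Real.exp (2 * x * ε) * (μ.real (crossSet X x n (T * n)) + g) := by
  have hnT : n ≤ T * n := Nat.le_mul_of_pos_left n hT
  have he0 : 0 ≤ e := he ▸ abs_nonneg _
  have hT0 : (1 : ℝ) ≤ T := by exact_mod_cast hT
  have hn0 : (1 : ℝ) ≤ n := by exact_mod_cast hn
  have he2 : e ≤ 1 := by
    have : 1 * (1 * e) ≤ T * (n * e) := by gcongr
    linarith
  have h1 : μ.real (stayBelow (expProc X x ε n) n (T * n))ᶜ
      ≤ μ.real (crossSet X x n (T * n)) + g :=
    hg ▸ measureReal_le_add_of_iff fun ω hω h => (cross_iff hx hn hω).2 h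
  have h2 := maximal_lower (measurable_expProc hX x ε n) (integrable_expProc (μ := μ) hX hx hε hn)
    (fun k ω => (Real.exp_pos _).le) (q := 1 - e) (K := Real.exp (2 * x * ε)) (n := n)
    (by linarith) (by linarith) (Real.one_le_exp (by positivity))
    (fun k ω hk => by
      rw [expProc_succ, ← one_mul (Real.exp (2 * x * ε))]
      exact mul_le_mul hk (Real.exp_le_exp.2 (incr_le hx hε hn _)) (Real.exp_pos _).le zero_le_one)
    (fun N hN => by
      rw [expProc_step hX hindep hident x ε hn hN]
      refine mul_le_mul_of_nonneg_right ?_ (integral_nonneg fun ω => (Real.exp_pos _).le)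
      have := neg_abs_le (∫ ω, Real.exp (incr x ε n (X 0 ω)) ∂μ - 1)
      linarith) (T * n - n)
  rw [Nat.add_sub_cancel' hnT] at h2
  have h3 := setIntegral_stayBelow_le (measurable_expProc hX x ε n)
    (integrable_expProc (μ := μ) hX hx hε hn) (fun k ω => (Real.exp_pos _).le) hnT
  have h4 := le_min_expProc (μ := μ) hX (x := x) (ε := ε) hn le_rfl
    (by simpa using hnT : 1 * n ≤ T * n)
  simp only [Nat.cast_one, Real.sqrt_one, mul_one, one_mul] at h4
  rw [← hg] at h4
  have h4' := min_expProc_le (μ := μ) hX (x := x) (ε := ε) hn hT (le_refl (T * n))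
  rw [← hg] at h4'
  have h5 : 1 - T * (n * e) ≤ (1 - e) ^ (T * n - n) := by
    calc 1 - T * (n * e) = 1 + (T * n : ℕ) * (-e) := by push_cast; ring
      _ ≤ (1 + -e) ^ (T * n) := one_add_mul_le_pow (by linarith) _
      _ ≤ (1 - e) ^ (T * n - n) := by
        rw [← sub_eq_add_neg]
        exact pow_le_pow_of_le_one (by linarith) (by linarith) (Nat.sub_le _ _)
  have h6 : 0 ≤ ∫ ω, min 1 (expProc X x ε n n ω) ∂μ :=
    integral_nonneg fun ω => min_one_exp_nonneg _
  calc (1 - T * (n * e)) * (cltInt μ X x n - g)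
      ≤ (1 - T * (n * e)) * ∫ ω, min 1 (expProc X x ε n n ω) ∂μ := by
        apply mul_le_mul_of_nonneg_left _ (by linarith); linarith
    _ ≤ (1 - e) ^ (T * n - n) * ∫ ω, min 1 (expProc X x ε n n ω) ∂μ :=
        mul_le_mul_of_nonneg_right h5 h6
    _ ≤ _ := h2
    _ ≤ _ := add_le_add (h3.trans h4') (mul_le_mul_of_nonneg_left h1 (Real.exp_pos _).le)

end FinalPart


section LimitPart
variable {Ω : Type*} [MeasurableSpace Ω] {μ : Measure Ω} [IsProbabilityMeasure μ]

/-- The crossing event on `[n, ∞)`. -/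
def crossInf (X : ℕ → Ω → ℝ) (x : ℝ) (n : ℕ) : Set Ω :=
  {ω | ∃ k : ℕ, n ≤ k ∧ x / √n * k < ∑ j ∈ Finset.range k, X j ω}

lemma measurableSet_crossInf {X : ℕ → Ω → ℝ} (hX : ∀ i, Measurable (X i)) (x : ℝ) (n : ℕ) :
    MeasurableSet (crossInf X x n) := by
  have : crossInf X x n = ⋃ k : ℕ, ⋃ _ : n ≤ k,
      {ω | x / √n * k < ∑ j ∈ Finset.range k, X j ω} := by
    ext ω; simp [crossInf]
  rw [this]
  exact MeasurableSet.iUnion fun k => MeasurableSet.iUnion fun _ =>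
    measurableSet_lt measurable_const (by fun_prop)

lemma crossInf_ge {X : ℕ → Ω → ℝ} (x : ℝ) (n N : ℕ) :
    μ.real (crossSet X x n N) ≤ μ.real (crossInf X x n) :=
  measureReal_mono fun _ ⟨k, h1, _, h3⟩ => ⟨k, h1, h3⟩

lemma crossInf_le {X : ℕ → Ω → ℝ} (hX : ∀ i, Measurable (X i)) (hindep : iIndepFun X μ)
    (hident : ∀ i, IdentDistrib (X i) (X 0) μ μ) (h0 : ∫ ω, X 0 ω ∂μ = 0)
    (h1 : ∫ ω, X 0 ω ^ 2 ∂μ = 1) (hL2 : ∀ i, MemLp (X i) 2 μ) {x : ℝ} (hx : 0 < x) {n T : ℕ}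
    (hn : 1 ≤ n) (hT : 1 ≤ T) :
    μ.real (crossInf X x n) ≤ μ.real (crossSet X x n (T * n)) + 2 / (T * x ^ 2) := by
  have hn0 : (1 : ℝ) ≤ n := by exact_mod_cast hn
  have hs : 0 < √(n : ℝ) := Real.sqrt_pos.2 (by linarith)
  have hsq : √(n : ℝ) ^ 2 = n := Real.sq_sqrt (by linarith)
  have hb := tail_bound hX hindep hident h0 h1 hL2 (m := T * n) (Nat.mul_pos hT hn)
    (l := x / √n) (by positivity)
  have e : 2 / (((T * n : ℕ) : ℝ) * (x / √n) ^ 2) = 2 / (T * x ^ 2) := by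
    rw [div_pow, hsq]; push_cast; congr 1; field_simp
  rw [e] at hb
  have : crossInf X x n ⊆ crossSet X x n (T * n) ∪
      {ω | ∃ i : ℕ, T * n ≤ i ∧ x / √n * i < ∑ j ∈ Finset.range i, X j ω} := by
    rintro ω ⟨k, hk1, hk2⟩
    rcases le_total k (T * n) with h | h
    · exact Or.inl ⟨k, hk1, h, hk2⟩
    · exact Or.inr ⟨k, h, hk2⟩
  calc _ ≤ _ := measureReal_mono this
    _ ≤ _ := measureReal_union_le _ _
    _ ≤ _ := by gcongr

lemma tendsto_crossInf {X : ℕ → Ω → ℝ} (hX : ∀ i, Measurable (X i)) (hindep : iIndepFun X μ)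
    (hident : ∀ i, IdentDistrib (X i) (X 0) μ μ) (h0 : ∫ ω, X 0 ω ∂μ = 0)
    (h1 : ∫ ω, X 0 ω ^ 2 ∂μ = 1) (hL2 : ∀ i, MemLp (X i) 2 μ) {x : ℝ} (hx : 0 < x) :
    Tendsto (fun n => μ.real (crossInf X x n)) atTop (nhds (crossProb x)) := by
  have hclt : ∀ y, Tendsto (cltInt μ X y) atTop (nhds (crossProb y)) := fun y =>
    clt_crossProb hindep hident h0 h1 y
  -- the error terms
  have he : ∀ T : ℕ, 1 ≤ T → Tendsto (fun n : ℕ => (T : ℝ) *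
      (n * |∫ ω, Real.exp (incr x (1 / T) n (X 0 ω)) ∂μ - 1|)) atTop (nhds 0) := by
    intro T hT
    have hT0 : (1 : ℝ) ≤ T := by exact_mod_cast hT
    simpa using (tendsto_rho (hX 0) h0 h1 (hL2 0) hx
      (by positivity : (0 : ℝ) < 1 / T)).const_mul (T : ℝ)
  have hg : ∀ T : ℕ, 1 ≤ T → Tendsto (fun n : ℕ => μ.real
      (goodSet X (1 / T * √n) (T * n))ᶜ) atTop (nhds 0) := by
    intro T hT
    have hT0 : (1 : ℝ) ≤ T := by exact_mod_cast hT
    have := (tendsto_trunc_prob (μ := μ) (hX 0) (hL2 0)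
      (by positivity : (0 : ℝ) < 1 / T)).const_mul (T : ℝ)
    rw [mul_zero] at this
    refine squeeze_zero (fun n => measureReal_nonneg) (fun n => ?_) this
    refine (goodSet_compl_le hident _ _).trans (le_of_eq ?_)
    push_cast; ring
  have hTinv : Tendsto (fun T : ℕ => 1 / (T : ℝ)) atTop (nhds 0) := tendsto_one_div_atTop_nhds_zero_nat
  rw [tendsto_order]
  constructor
  · intro a ha
    have hlim : Tendsto (fun T : ℕ => (crossProb x - crossProb (x * √T))
        / Real.exp (2 * x * (1 / T))) atTop (nhds (crossProb x)) := by
      have l1 : Tendsto (fun T : ℕ => crossProb (x * √T)) atTop (nhds 0) :=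
        tendsto_crossProb_atTop.comp ((Real.tendsto_sqrt_atTop.comp
          tendsto_natCast_atTop_atTop).const_mul_atTop hx)
      have l2 : Tendsto (fun T : ℕ => Real.exp (2 * x * (1 / T))) atTop (nhds 1) := by
        have := (Real.continuous_exp.tendsto _).comp (hTinv.const_mul (2 * x))
        simpa [Function.comp_def] using this
      have := (l1.const_sub (crossProb x)).div l2 one_ne_zero
      simpa [Pi.div_def] using this
    obtain ⟨T, hTa, hT⟩ := ((hlim.eventually_const_lt ha).and (eventually_ge_atTop 1)).exists
    have hT0 : (1 : ℝ) ≤ T := by exact_mod_cast hT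
    have hTn : Tendsto (fun n : ℕ => T * n) atTop atTop :=
      tendsto_id.const_mul_atTop' hT
    have hL : Tendsto (fun n : ℕ => ((1 - (T : ℝ) *
          (n * |∫ ω, Real.exp (incr x (1 / T) n (X 0 ω)) ∂μ - 1|)) *
          (cltInt μ X x n - μ.real (goodSet X (1 / T * √n) (T * n))ᶜ)
        - cltInt μ X (x * √T) (T * n) - μ.real (goodSet X (1 / T * √n) (T * n))ᶜ)
          / Real.exp (2 * x * (1 / T)) - μ.real (goodSet X (1 / T * √n) (T * n))ᶜ) atTop
        (nhds (((1 - 0) * (crossProb x - 0) - crossProb (x * √T) - 0)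
          / Real.exp (2 * x * (1 / T)) - 0)) :=
      (((((he T hT).const_sub 1).mul ((hclt x).sub (hg T hT))).sub
        ((hclt (x * √T)).comp hTn)).sub (hg T hT)).div_const _ |>.sub (hg T hT)
    have ha' : a < ((1 - 0) * (crossProb x - 0) - crossProb (x * √T) - 0)
          / Real.exp (2 * x * (1 / T)) - 0 := by simpa using hTa
    filter_upwards [hL.eventually_const_lt ha', eventually_ge_atTop 1,
      (he T hT).eventually_le_const one_pos] with n h2 hn hen
    refine h2.trans_le (le_trans ?_ (crossInf_ge x n (T * n)))
    have := cross_lower hX hindep hident hx (by positivity : (0 : ℝ) < 1 / T) hn hT rfl rfl hen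
    rw [sub_le_iff_le_add, div_le_iff₀ (Real.exp_pos _)]
    linarith
  · intro a ha
    have hlim : Tendsto (fun T : ℕ => crossProb x + 2 / (T * x ^ 2)) atTop
        (nhds (crossProb x)) := by
      have := (hTinv.const_mul (2 / x ^ 2)).const_add (crossProb x)
      simp only [mul_zero, add_zero] at this
      refine this.congr fun T => ?_
      congr 1
      rw [div_mul_div_comm, mul_one, mul_comm]
    obtain ⟨T, hTa, hT⟩ := ((hlim.eventually_lt_const ha).and (eventually_ge_atTop 1)).exists
    have hT0 : (1 : ℝ) ≤ T := by exact_mod_cast hT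
    have hU : Tendsto (fun n : ℕ => Real.exp ((T : ℝ) *
          (n * |∫ ω, Real.exp (incr x (1 / T) n (X 0 ω)) ∂μ - 1|)) *
          (cltInt μ X x n + μ.real (goodSet X (1 / T * √n) (T * n))ᶜ)
          + μ.real (goodSet X (1 / T * √n) (T * n))ᶜ + 2 / (T * x ^ 2)) atTop
        (nhds (Real.exp 0 * (crossProb x + 0) + 0 + 2 / (T * x ^ 2))) :=
      ((((Real.continuous_exp.tendsto 0).comp (he T hT)).mul ((hclt x).add (hg T hT))).add
        (hg T hT)).add_const _
    have ha' : Real.exp 0 * (crossProb x + 0) + 0 + 2 / (T * x ^ 2) < a := by simpa using hTa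
    filter_upwards [hU.eventually_lt_const ha', eventually_ge_atTop 1] with n h2 hn
    refine lt_of_le_of_lt ?_ h2
    have h3 := crossInf_le hX hindep hident h0 h1 hL2 hx hn hT
    have h4 := cross_upper hX hindep hident hx (by positivity : (0 : ℝ) < 1 / T) hn hT rfl rfl
    linarith

end LimitPart

theorem sqrt_n_mul_supSampleMean_tendsto_absGaussian
    {Ω : Type*} [MeasureSpace Ω] [IsProbabilityMeasure (ℙ : Measure Ω)]
    (X : ℕ → Ω → ℝ) (hmeas : ∀ i, Measurable (X i))
    (hindep : iIndepFun X ℙ)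
    (hident : ∀ i, IdentDistrib (X i) (X 0) ℙ ℙ)
    (hmean : ∫ ω, X 0 ω ∂ℙ = 0)
    (hvar : variance (X 0) ℙ = 1)
    (p : ℝ) (hp : 2 < p)
    (hmom : Integrable (fun ω => |X 0 ω| ^ p) ℙ)
    (M : ℕ → Ω → ℝ)
    (hM : ∀ n ω, M n ω = ⨆ i : {i : ℕ // n ≤ i}, (∑ j ∈ Finset.range i, X j ω) / i) :
    ∀ x : ℝ,
      Tendsto (fun n : ℕ => (ℙ {ω | Real.sqrt n * M n ω ≤ x}).toReal) atTop
        (nhds ((gaussianReal 0 1 {y : ℝ | |y| ≤ x}).toReal)) := by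
  have hL20 : MemLp (X 0) 2 ℙ :=
    memLp_two_of_variance_ne_zero (hmeas 0).aestronglyMeasurable (by rw [hvar]; exact one_ne_zero)
  have hL2 : ∀ i, MemLp (X i) 2 ℙ := fun i => (hident i).memLp_iff.2 hL20
  have h1 : ∫ ω, X 0 ω ^ 2 ∂ℙ = 1 := by
    rw [← hvar, variance_of_integral_eq_zero (hmeas 0).aemeasurable hmean]
  have hslln : ∀ᵐ ω ∂(ℙ : Measure Ω),
      Tendsto (fun n : ℕ => (∑ i ∈ Finset.range n, X i ω) / n) atTop (nhds 0) := by
    have := strong_law_ae_real X (hL20.integrable one_le_two)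
      (fun i j hij => hindep.indepFun hij) hident
    rwa [hmean] at this
  have hbdd : ∀ ω, Tendsto (fun n : ℕ => (∑ i ∈ Finset.range n, X i ω) / n) atTop (nhds 0) →
      ∀ n : ℕ, BddAbove (Set.range fun i : {i : ℕ // n ≤ i} =>
        (∑ j ∈ Finset.range i, X j ω) / ((i : ℕ) : ℝ)) := by
    intro ω hω n
    refine hω.bddAbove_range.mono ?_
    rintro _ ⟨i, rfl⟩
    exact ⟨i, rfl⟩
  have hMpos : ∀ᵐ ω ∂(ℙ : Measure Ω), ∀ n, 0 ≤ M n ω := by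
    filter_upwards [hslln] with ω hω n
    refine le_of_tendsto hω ?_
    filter_upwards [eventually_ge_atTop n] with i hi
    rw [hM]
    exact le_ciSup (hbdd ω hω n) ⟨i, hi⟩
  have hpos : ∀ x : ℝ, 0 < x →
      Tendsto (fun n : ℕ => (ℙ {ω | Real.sqrt n * M n ω ≤ x}).toReal) atTop
        (nhds ((gaussianReal 0 1 {y : ℝ | |y| ≤ x}).toReal)) := by
    intro x hx
    have hlim := (tendsto_crossInf hmeas hindep hident hmean h1 hL2 hx).const_sub 1
    have e : 1 - crossProb x = (gaussianReal 0 1 {y : ℝ | |y| ≤ x}).toReal := by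
      rw [crossProb_eq hx.le]; ring
    rw [e] at hlim
    refine hlim.congr' ?_
    filter_upwards [eventually_ge_atTop 1] with n hn
    have hn0 : (1 : ℝ) ≤ n := by exact_mod_cast hn
    have hs : 0 < √(n : ℝ) := Real.sqrt_pos.2 (by linarith)
    rw [← probReal_compl_eq_one_sub (measurableSet_crossInf hmeas x n), measureReal_def]
    congr 1
    apply measure_congr
    filter_upwards [hslln] with ω hω
    apply propext
    change ω ∈ (crossInf X x n)ᶜ ↔ Real.sqrt n * M n ω ≤ x
    have hne : Nonempty {i : ℕ // n ≤ i} := ⟨⟨n, le_rfl⟩⟩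
    rw [mul_comm, ← le_div_iff₀ hs, hM, ciSup_le_iff (hbdd ω hω n)]
    simp only [crossInf, Set.mem_compl_iff, Set.mem_ofPred_eq, not_exists, not_and, not_lt]
    constructor
    · rintro h ⟨i, hi⟩
      have hi0 : (0 : ℝ) < i := by exact_mod_cast (by omega : 0 < i)
      rw [div_le_iff₀ hi0]
      exact h i hi
    · intro h i hi
      have hi0 : (0 : ℝ) < i := by exact_mod_cast (by omega : 0 < i)
      rw [← div_le_iff₀ hi0]
      exact h ⟨i, hi⟩
  intro x
  rcases lt_trichotomy x 0 with hx | hx | hx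
  · have e1 : {y : ℝ | |y| ≤ x} = ∅ := by
      ext y
      simp only [Set.mem_ofPred_eq, Set.mem_empty_iff_false, iff_false, not_le]
      exact hx.trans_le (abs_nonneg y)
    rw [e1, measure_empty, ENNReal.toReal_zero]
    refine tendsto_const_nhds.congr fun n => ?_
    symm
    have : ℙ {ω | Real.sqrt n * M n ω ≤ x} = 0 := by
      rw [← compl_compl {ω | Real.sqrt n * M n ω ≤ x}, ← mem_ae_iff]
      filter_upwards [hMpos] with ω hω
      change ¬ (Real.sqrt n * M n ω ≤ x)
      have := mul_nonneg (Real.sqrt_nonneg n) (hω n)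
      linarith
    rw [this, ENNReal.toReal_zero]
  · subst hx
    have e0 : (gaussianReal 0 1 {y : ℝ | |y| ≤ 0}).toReal = 0 := by
      have := crossProb_eq (le_refl (0 : ℝ))
      rw [crossProb_zero] at this
      linarith
    rw [e0, tendsto_order]
    refine ⟨fun a ha => Eventually.of_forall fun n => ha.trans_le ENNReal.toReal_nonneg,
      fun a ha => ?_⟩
    have hc : Tendsto (fun d : ℕ => 1 - crossProb (1 / ((d : ℝ) + 1))) atTop (nhds 0) := by
      have := ((continuous_crossProb.tendsto 0).comp
        (tendsto_one_div_add_atTop_nhds_zero_nat (𝕜 := ℝ))).const_sub 1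
      simpa [crossProb_zero, Function.comp_def] using this
    obtain ⟨d, hd⟩ := (hc.eventually_lt_const ha).exists
    have hdpos : (0 : ℝ) < 1 / ((d : ℝ) + 1) := by positivity
    have h2 := hpos _ hdpos
    have e : (gaussianReal 0 1 {y : ℝ | |y| ≤ 1 / ((d : ℝ) + 1)}).toReal
        = 1 - crossProb (1 / ((d : ℝ) + 1)) := by
      rw [crossProb_eq hdpos.le]; ring
    rw [← e] at hd
    filter_upwards [h2.eventually_lt_const hd] with n hn
    refine lt_of_le_of_lt (ENNReal.toReal_mono (measure_ne_top _ _) (measure_mono ?_)) hn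
    intro ω hω
    exact le_trans hω hdpos.le
  · exact hpos x hx
end
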